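/- arXiv:2406.08241 — 8 statements merged into one kernel-verified Lean document; each statement's English description precedes it below -/
import Mathlib

section
/- Let f be a probability density function on ℝ that is symmetric about θ (i.e., f(θ+x) = f(θ−x) for all x) and unimodal about θ (i.e., x ↦ f(θ+x) is a strictly decreasing function of |x| over its support). Let K be a differentiable probability density kernel with bounded derivative K′ that is symmetric and unimodal about zero. Then for every bandwidth h > 0, the smoothed density f_h(x) = ∫ K_h(x−y) f(y) dy, where K_h(u) = K(u/h)/h, is also symmetric and unimodal about θ. -/
open MeasureTheory Real Filter Topology Set

noncomputable section

/-- A probability density function on ℝ. -/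
def IsPDF (f : ℝ → ℝ) : Prop :=
  (∀ x, 0 ≤ f x) ∧ MeasureTheory.Integrable f ∧ (∫ x, f x) = 1

/-- `f` is symmetric about `θ`. -/
def SymmAbout (f : ℝ → ℝ) (θ : ℝ) : Prop := ∀ x, f (θ + x) = f (θ - x)

/-- `f` is unimodal about `θ`: `x ↦ f (θ + x)` is a strictly decreasing
function of `|x|` over its support. -/
def UnimodalAbout (f : ℝ → ℝ) (θ : ℝ) : Prop :=
  ∀ x y : ℝ, |x| < |y| → f (θ + y) ≠ 0 → f (θ + y) < f (θ + x)

/-- The rescaled kernel `K_h(x) = K(x/h)/h`. -/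
def Kh (K : ℝ → ℝ) (h x : ℝ) : ℝ := K (x / h) / h

/-- The smoothed density `f_h = K_h * f` (convolution). -/
def smoothed (K f : ℝ → ℝ) (h x : ℝ) : ℝ := ∫ y, Kh K h (x - y) * f y

lemma aux_even (k f : ℝ → ℝ) (hke : ∀ u, k (-u) = k u) (hfe : ∀ u, f (-u) = f u) (x : ℝ) :
    (∫ t, k (-x - t) * f t) = ∫ t, k (x - t) * f t := by
  rw [← integral_neg_eq_self]
  congr 1
  funext t
  rw [hfe, ← hke]
  congr 2
  ring

lemma aux_uni (k f : ℝ → ℝ) (hk0 : ∀ u, 0 ≤ k u) (hkc : Continuous k)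
    (hke : ∀ u, k (-u) = k u) (hku : ∀ u v : ℝ, |u| < |v| → k v ≠ 0 → k v < k u)
    (hf0 : ∀ u, 0 ≤ f u) (hfi : Integrable f)
    (hfu : ∀ u v : ℝ, |u| < |v| → f v ≠ 0 → f v < f u)
    (x y : ℝ) (hx : 0 ≤ x) (hxy : x < y) (hy : (∫ t, k (y - t) * f t) ≠ 0) :
    (∫ t, k (y - t) * f t) < ∫ t, k (x - t) * f t := by
  have hkb : ∀ u, k u ≤ k 0 := by
    intro u
    by_cases hu : u = 0
    · rw [hu]
    · by_cases h : k u = 0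
      · rw [h]; exact hk0 0
      · exact (hku 0 u (by simpa using hu) h).le
  have hint : ∀ z (g : ℝ → ℝ), Integrable g → Integrable (fun t => k (z - t) * g t) := by
    intro z g hg
    refine hg.bdd_mul (c := k 0) (by fun_prop) (ae_of_all _ fun t => ?_)
    rw [Real.norm_eq_abs, abs_of_nonneg (hk0 _)]
    exact hkb _
  have hfi' : Integrable (fun t => f (x + y - t)) := hfi.comp_sub_left (x + y)
  have r1 : (∫ t, k (x - t) * f t) = ∫ t, k (y - t) * f (x + y - t) := by
    rw [← integral_sub_left_eq_self _ volume (x + y)]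
    congr 1; funext t
    rw [← hke]; congr 2; ring
  have r2 : (∫ t, k (y - t) * f t) = ∫ t, k (x - t) * f (x + y - t) := by
    rw [← integral_sub_left_eq_self _ volume (x + y)]
    congr 1; funext t
    rw [← hke]; congr 2; ring
  have i1 := hint x f hfi
  have i2 := hint y f hfi
  have i3 := hint x _ hfi'
  have i4 := hint y _ hfi'
  set P : ℝ → ℝ := fun t => (k (x - t) - k (y - t)) * (f t - f (x + y - t)) with hP
  have hPe : P = fun t => (k (x - t) * f t - k (y - t) * f t)
      - (k (x - t) * f (x + y - t) - k (y - t) * f (x + y - t)) := by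
    funext t; simp only [hP]; ring
  have hPi : Integrable P := by
    rw [hPe]; exact (i1.sub i2).sub (i3.sub i4)
  have hPv : ∫ t, P t = 2 * ((∫ t, k (x - t) * f t) - ∫ t, k (y - t) * f t) := by
    have e1 := integral_sub (i1.sub i2) (i3.sub i4)
    simp only [Pi.sub_apply] at e1
    rw [integral_sub i1 i2, integral_sub i3 i4, ← r1, ← r2] at e1
    rw [hPe]
    refine e1.trans ?_
    ring
  have wk : ∀ u v : ℝ, |u| < |v| → k v ≤ k u := by
    intro u v h
    by_cases h' : k v = 0
    · rw [h']; exact hk0 u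
    · exact (hku u v h h').le
  have wf : ∀ u v : ℝ, |u| < |v| → f v ≤ f u := by
    intro u v h
    by_cases h' : f v = 0
    · rw [h']; exact hf0 u
    · exact (hfu u v h h').le
  have a1 : ∀ t, t < (x + y) / 2 → |x - t| < |y - t| ∧ |t| < |x + y - t| := by
    intro t ht
    constructor <;> rw [← sq_lt_sq] <;> nlinarith
  have a2 : ∀ t, (x + y) / 2 < t → |y - t| < |x - t| ∧ |x + y - t| < |t| := by
    intro t ht
    constructor <;> rw [← sq_lt_sq] <;> nlinarith
  have hP0 : ∀ t, 0 ≤ P t := by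
    intro t
    rcases lt_trichotomy t ((x + y) / 2) with h | h | h
    · obtain ⟨h1, h2⟩ := a1 t h
      exact mul_nonneg (sub_nonneg.2 (wk _ _ h1)) (sub_nonneg.2 (wf _ _ h2))
    · have : x + y - t = t := by linarith
      simp only [hP]; rw [this]; simp
    · obtain ⟨h1, h2⟩ := a2 t h
      exact mul_nonneg_of_nonpos_of_nonpos (sub_nonpos.2 (wk _ _ h1)) (sub_nonpos.2 (wf _ _ h2))
  have hPnn : 0 ≤ ∫ t, P t := integral_nonneg hP0
  by_contra hcon
  push Not at hcon
  have hz : ∫ t, P t = 0 := by linarith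
  have hae := (integral_eq_zero_iff_of_nonneg hP0 hPi).1 hz
  apply hy
  apply integral_eq_zero_of_ae
  have hne : ∀ᵐ t : ℝ, t ≠ (x + y) / 2 := by
    simp [ae_iff]
  filter_upwards [hae, hne] with t ht htn
  simp only [Pi.zero_apply, hP] at ht ⊢
  by_contra hnz
  have n1 : k (y - t) ≠ 0 := left_ne_zero_of_mul hnz
  have n2 : f t ≠ 0 := right_ne_zero_of_mul hnz
  rcases lt_or_gt_of_ne htn with h | h
  · obtain ⟨h1, h2⟩ := a1 t h
    have b1 := hku _ _ h1 n1
    rcases mul_eq_zero.1 ht with h3 | h3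
    · linarith
    · have h4 : f (x + y - t) ≠ 0 := by rw [← sub_eq_zero.1 h3]; exact n2
      have := hfu _ _ h2 h4
      linarith
  · obtain ⟨h1, h2⟩ := a2 t h
    have b1 := hfu _ _ h2 n2
    rcases mul_eq_zero.1 ht with h3 | h3
    · have h4 : k (x - t) ≠ 0 := by rw [sub_eq_zero.1 h3]; exact n1
      have := hku _ _ h1 h4
      linarith
    · linarith

theorem smoothed_symm_unimodal (f K : ℝ → ℝ) (θ : ℝ)
    (hf : IsPDF f) (hfs : SymmAbout f θ) (hfu : UnimodalAbout f θ)
    (hK : IsPDF K) (hKdiff : Differentiable ℝ K)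
    (hKbdd : ∃ C, ∀ x, |deriv K x| ≤ C)
    (hKs : SymmAbout K 0) (hKu : UnimodalAbout K 0) :
    ∀ h : ℝ, 0 < h →
      SymmAbout (smoothed K f h) θ ∧ UnimodalAbout (smoothed K f h) θ := by
  intro h hh
  have key : ∀ x, smoothed K f h (θ + x) = ∫ t, Kh K h (x - t) * f (θ + t) := by
    intro x
    unfold smoothed
    rw [← integral_add_left_eq_self _ θ]
    congr 1; funext t
    congr 2; ring
  have hke : ∀ u, Kh K h (-u) = Kh K h u := by
    intro u
    have := hKs (u / h)
    simp only [zero_add, zero_sub] at this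
    simp only [Kh, neg_div, this]
  have hfe : ∀ u, f (θ + -u) = f (θ + u) := by
    intro u
    rw [hfs u]; rfl
  have hev : ∀ x, smoothed K f h (θ + -x) = smoothed K f h (θ + x) := by
    intro x
    rw [key, key]
    exact aux_even (Kh K h) (fun t => f (θ + t)) hke hfe x
  have habs : ∀ x, smoothed K f h (θ + |x|) = smoothed K f h (θ + x) := by
    intro x
    rcases abs_choice x with h | h <;> rw [h]
    exact hev x
  refine ⟨fun x => by rw [← hev x]; rfl, fun x y hxy hy => ?_⟩
  rw [← habs x, ← habs y]
  rw [← habs y] at hy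
  rw [key] at hy
  rw [key, key]
  refine aux_uni (Kh K h) (fun t => f (θ + t)) (fun u => div_nonneg (hK.1 _) hh.le) ?_ hke ?_
    (fun u => hf.1 _) (hf.2.1.comp_add_left θ) hfu _ _ (abs_nonneg x) hxy hy
  · have := hKdiff.continuous
    unfold Kh
    fun_prop
  · intro u v huv hv
    unfold Kh at *
    have := hKu (u / h) (v / h) (by
      rw [abs_div, abs_div]
      exact div_lt_div_of_pos_right huv (abs_pos.2 hh.ne')) (by
      rw [zero_add]; intro h0; apply hv; rw [h0]; simp)
    simp only [zero_add] at this
    exact div_lt_div_of_pos_right this hh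
end
end

section
/- Let f be a pdf on ℝ symmetric about θ, write f₀(x) = f(θ+x), and let K be a differentiable pdf kernel with bounded derivative K′, symmetric about zero. Then for every h > 0 and every x ∈ ℝ, the derivative of the smoothed density satisfies f_h′(θ+x) = ∫₀^∞ [f₀(x−y) − f₀(x+y)] K_h′(y) dy, where f_h = K_h * f and K_h(u) = K(u/h)/h. -/
open MeasureTheory Real Filter Topology Set

noncomputable section

lemma kernel_bdd (K : ℝ → ℝ) (hK : IsPDF K) (hKdiff : Differentiable ℝ K) (C : ℝ)
    (hC : ∀ x, |deriv K x| ≤ C) (t : ℝ) : |K t| ≤ 1 + C := by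
  obtain ⟨h0, hi, h1⟩ := hK
  rw [abs_of_nonneg (h0 t)]
  have hC0 : 0 ≤ C := (abs_nonneg _).trans (hC 0)
  have hlip : ∀ s ∈ Icc t (t+1), K t - C ≤ K s := by
    intro s hs
    have := Convex.norm_image_sub_le_of_norm_deriv_le (f := K) (C := C) (s := univ) (x := t) (y := s)
      (fun x _ => hKdiff x) (fun x _ => hC x) convex_univ (mem_univ _) (mem_univ _)
    rw [Real.norm_eq_abs, Real.norm_eq_abs, abs_of_nonneg (by linarith [hs.1] : 0 ≤ s - t)] at this
    have h2 := neg_abs_le (K s - K t)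
    nlinarith [hs.2]
  have h3 : ∫ s in Icc t (t+1), (K t - C) ≤ ∫ s in Icc t (t+1), K s :=
    setIntegral_mono_on (by simp) hi.integrableOn measurableSet_Icc hlip
  have h4 : ∫ s in Icc t (t+1), K s ≤ ∫ s, K s :=
    setIntegral_le_integral hi (Eventually.of_forall h0)
  simp at h3
  linarith

theorem deriv_smoothed_formula (f K : ℝ → ℝ) (θ : ℝ)
    (hf : IsPDF f) (hfs : SymmAbout f θ)
    (hK : IsPDF K) (hKdiff : Differentiable ℝ K)
    (hKbdd : ∃ C, ∀ x, |deriv K x| ≤ C)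
    (hKs : SymmAbout K 0) :
    ∀ h : ℝ, 0 < h → ∀ x : ℝ,
      deriv (smoothed K f h) (θ + x) =
        ∫ y in Set.Ioi (0 : ℝ),
          (f (θ + (x - y)) - f (θ + (x + y))) * deriv (Kh K h) y := by
  obtain ⟨C, hC⟩ := hKbdd
  intro h hh x
  set g := Kh K h with hg
  have hgd : ∀ y, HasDerivAt g (deriv K (y / h) * (1 / h) / h) y := by
    intro y
    have h1 : HasDerivAt (fun z : ℝ => z / h) (1 / h) y := (hasDerivAt_id y).div_const h
    exact ((hKdiff (y / h)).hasDerivAt.comp y h1).div_const h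
  have hgdiff : Differentiable ℝ g := fun y => (hgd y).differentiableAt
  have hgb : ∀ y, ‖deriv g y‖ ≤ C * (1 / h) / h := by
    intro y
    rw [(hgd y).deriv, Real.norm_eq_abs, abs_div, abs_mul, abs_of_pos hh,
      abs_of_pos (by positivity : 0 < 1 / h)]
    gcongr
    exact hC _
  have hgbd : ∀ y, ‖g y‖ ≤ (1 + C) / h := by
    intro y
    simp only [hg, Kh]
    rw [Real.norm_eq_abs, abs_div, abs_of_pos hh]
    gcongr
    exact kernel_bdd K hK hKdiff C hC _
  have hgeven : ∀ y, g (-y) = g y := by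
    intro y
    have := hKs (y / h)
    simp only [zero_add, zero_sub] at this
    simp only [hg, Kh, neg_div, this]
  have hgodd : ∀ y, deriv g (-y) = - deriv g y := by
    intro y
    have h1 := deriv_comp_neg g y
    rw [show (fun x => g (-x)) = g from funext hgeven] at h1
    linarith
  have hfi := hf.2.1
  have key := hasDerivAt_integral_of_dominated_loc_of_deriv_le (μ := volume) (s := univ) (x₀ := θ + x)
    (F := fun z y => g (z - y) * f y) (F' := fun z y => deriv g (z - y) * f y)
    (bound := fun y => C * (1 / h) / h * ‖f y‖) univ_mem
    (Eventually.of_forall fun z =>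
      ((hgdiff.continuous.comp (continuous_const.sub continuous_id)).aestronglyMeasurable.mul
        hfi.aestronglyMeasurable))
    (hfi.bdd_mul (hgdiff.continuous.comp (continuous_const.sub continuous_id)).aestronglyMeasurable
      (Eventually.of_forall fun y => hgbd _))
    ((((measurable_deriv g).comp (measurable_const.sub measurable_id)).aestronglyMeasurable).mul
        hfi.aestronglyMeasurable)
    (Eventually.of_forall fun y z _ => by
      rw [norm_mul]; gcongr; exact hgb _)
    (hfi.norm.const_mul _)
    (Eventually.of_forall fun y z _ => by
      have h1 : HasDerivAt (fun w : ℝ => w - y) 1 z := (hasDerivAt_id z).sub_const y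
      have h2 := ((hgdiff (z - y)).hasDerivAt.comp z h1).mul_const (f y)
      simpa using h2)
  have hd : deriv (smoothed K f h) (θ + x) = ∫ y, deriv g (θ + x - y) * f y := key.2.deriv
  have I1 : Integrable (fun u => deriv g u * f (θ + x - u)) :=
    (hfi.comp_sub_left (θ + x)).bdd_mul (measurable_deriv g).aestronglyMeasurable
      (Eventually.of_forall hgb)
  have I2 : Integrable (fun u => deriv g u * f (θ + x + u)) :=
    (hfi.comp_add_left (θ + x)).bdd_mul (measurable_deriv g).aestronglyMeasurable
      (Eventually.of_forall hgb)
  have e1 : ∫ y, deriv g (θ + x - y) * f y = ∫ u, deriv g u * f (θ + x - u) := by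
    rw [← integral_sub_left_eq_self (fun u => deriv g u * f (θ + x - u)) volume (θ + x)]
    simp
  have e2 : ∫ u in Iic (0:ℝ), deriv g u * f (θ + x - u)
      = - ∫ u in Ioi (0:ℝ), deriv g u * f (θ + x + u) := by
    have := integral_comp_neg_Ioi 0 (fun u => deriv g u * f (θ + x - u))
    rw [neg_zero] at this
    rw [← this, ← integral_neg]
    congr 1
    ext u
    rw [hgodd, sub_neg_eq_add, neg_mul]
  rw [hd, e1, ← intervalIntegral.integral_Iic_add_Ioi I1.integrableOn I1.integrableOn (b := 0), e2,
    neg_add_eq_sub, ← integral_sub I1.integrableOn I2.integrableOn]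
  congr 1
  ext u
  rw [← add_sub_assoc, ← add_assoc]
  ring
end
end

section
/- Let f be a pdf symmetric and unimodal about θ, and let K be a bell-shaped kernel: a twice continuously differentiable pdf, symmetric and unimodal about zero, with bounded K′ and K″, having exactly two inflection points ±a (a > 0), so that K″(x) ≤ 0 for |x| < a and K″(x) ≥ 0 for |x| > a. Then for every h > 0, ∫_{−∞}^{∞} K_h″(θ − x) f(x) dx < 0, where K_h(u) = K(u/h)/h. -/
open MeasureTheory Real Filter Topology Set

noncomputable section

/-- A bell-shaped kernel: a twice continuously differentiable pdf, symmetric and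
unimodal about zero, with bounded first and second derivatives and exactly two
inflection points `±a`, i.e. `K'' ≤ 0` on `|x| < a` and `K'' ≥ 0` on `|x| > a`. -/
def BellShaped (K : ℝ → ℝ) : Prop :=
  IsPDF K ∧ ContDiff ℝ 2 K ∧ SymmAbout K 0 ∧ UnimodalAbout K 0 ∧
    (∃ C, ∀ x, |deriv K x| ≤ C) ∧ (∃ C, ∀ x, |deriv (deriv K) x| ≤ C) ∧
    ∃ a > (0 : ℝ), (∀ x, |x| < a → deriv (deriv K) x ≤ 0) ∧
      (∀ x, a < |x| → 0 ≤ deriv (deriv K) x)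

/-- The asymptotic variance of the kernel mode estimator:
`σ²_{K,h} = ∫ K_h'(θ-x)² f(x) dx / (∫ K_h''(θ-x) f(x) dx)²`. -/
def asympVar (K f : ℝ → ℝ) (θ h : ℝ) : ℝ :=
  (∫ x, (deriv (Kh K h) (θ - x)) ^ 2 * f x) /
    (∫ x, deriv (deriv (Kh K h)) (θ - x) * f x) ^ 2

theorem core_neg (L g : ℝ → ℝ) (A C : ℝ) (hL2 : ContDiff ℝ 2 L)
    (hL0 : ∀ x, 0 ≤ L x) (hLne : ∃ x, L x ≠ 0)
    (hLu : ∀ x y : ℝ, |x| < |y| → L y ≠ 0 → L y < L x)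
    (hC : ∀ x, |deriv (deriv L) x| ≤ C) (hA : 0 < A)
    (hin : ∀ x, |x| < A → deriv (deriv L) x ≤ 0)
    (hout : ∀ x, A < |x| → 0 ≤ deriv (deriv L) x)
    (hg0 : ∀ x, 0 ≤ g x) (hgi : Integrable g) (hg1 : ∫ x, g x = 1)
    (hgu : ∀ x y : ℝ, |x| < |y| → g y ≠ 0 → g y < g x) :
    (∫ x, deriv (deriv L) x * g x) < 0 := by
  have hLd : Differentiable ℝ L := hL2.differentiable (by norm_num)
  have hL1 : ContDiff ℝ 1 (deriv L) := ContDiff.deriv' hL2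
  have hLd1 : Differentiable ℝ (deriv L) := hL1.differentiable (by norm_num)
  have hMc : Continuous (deriv (deriv L)) := hL1.continuous_deriv (by norm_num)
  -- weak monotonicity
  have weak : ∀ (φ : ℝ → ℝ), (∀ x, 0 ≤ φ x) →
      (∀ x y : ℝ, |x| < |y| → φ y ≠ 0 → φ y < φ x) → ∀ x y, |x| < |y| → φ y ≤ φ x := by
    intro φ h0 hu x y hxy
    by_cases h : φ y = 0
    · rw [h]; exact h0 x
    · exact (hu x y hxy h).le
  have hLw := weak L hL0 hLu
  have hgw := weak g hg0 hgu
  have hLpos : 0 < L 0 := by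
    obtain ⟨x, hx⟩ := hLne
    by_cases h0 : x = 0
    · subst h0; exact lt_of_le_of_ne (hL0 _) (Ne.symm hx)
    · exact lt_of_le_of_lt (hL0 x) (hLu 0 x (by simpa using h0) hx)
  have hd0 : deriv L 0 = 0 := by
    apply IsLocalMax.deriv_eq_zero
    refine Filter.Eventually.of_forall fun x => ?_
    by_cases h0 : x = 0
    · rw [h0]
    · exact hLw 0 x (by simpa using h0)
  have hdneg : ∀ R, 0 < R → deriv L R ≤ 0 := by
    intro R hR
    have hanti : AntitoneOn L (Ici 0) := by
      intro x hx y hy hxy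
      rcases hxy.eq_or_lt with h | h
      · rw [h]
      · exact hLw x y (by rw [abs_of_nonneg hx, abs_of_nonneg hy]; exact h)
    have := hanti.derivWithin_nonpos (x := R)
    rwa [derivWithin_of_mem_nhds (Ici_mem_nhds hR)] at this
  have hdpos : ∀ R, 0 < R → 0 ≤ deriv L (-R) := by
    intro R hR
    have hmono : MonotoneOn L (Iic 0) := by
      intro x hx y hy hxy
      rcases hxy.eq_or_lt with h | h
      · rw [h]
      · exact hLw y x (by rw [abs_of_nonpos (show x ≤ 0 from hx), abs_of_nonpos (show y ≤ 0 from hy)]; linarith)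
    have := hmono.derivWithin_nonneg (x := -R)
    rwa [derivWithin_of_mem_nhds (Iic_mem_nhds (by linarith))] at this
  obtain ⟨r, hr, hrg⟩ : ∃ r > 0, ∀ u, |u| < r → g A < g u := by
    by_cases hgA : g A = 0
    · obtain ⟨u0, hu0, hgu0⟩ : ∃ u, u ≠ 0 ∧ g u ≠ 0 := by
        by_contra! hcon
        have : g =ᵐ[volume] 0 := by
          have h0 : ∀ᵐ x : ℝ, x ≠ 0 := by simp [ae_iff]
          filter_upwards [h0] with x hx using hcon x hx
        rw [integral_congr_ae this] at hg1
        simp at hg1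
      refine ⟨|u0|, abs_pos.2 hu0, fun u hu => ?_⟩
      rw [hgA]
      exact lt_of_le_of_lt (hg0 u0) (hgu u u0 hu hgu0)
    · exact ⟨A, hA, fun u hu => hgu u A (by rwa [abs_of_pos hA]) hgA⟩
  obtain ⟨p, hp0, hpr, hp⟩ : ∃ p, 0 < p ∧ p < r ∧ deriv (deriv L) p < 0 := by
    have hlt : L r < L 0 := by
      by_cases h : L r = 0
      · rwa [h]
      · exact hLu 0 r (by simpa using hr.ne') h
    obtain ⟨c, hc, hc'⟩ := exists_deriv_eq_slope L hr hLd.continuous.continuousOn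
      hLd.differentiableOn
    have hcneg : deriv L c < 0 := by
      rw [hc']; exact div_neg_of_neg_of_pos (by linarith) (by linarith)
    obtain ⟨d, hd, hd'⟩ := exists_deriv_eq_slope (deriv L) hc.1 hLd1.continuous.continuousOn
      hLd1.differentiableOn
    refine ⟨d, hd.1, hd.2.trans hc.2, ?_⟩
    rw [hd', hd0]
    exact div_neg_of_neg_of_pos (by linarith) (by linarith [hc.1])
  set M := deriv (deriv L) with hM
  have hMg : Integrable (fun x => M x * g x) :=
    hgi.bdd_mul hMc.aestronglyMeasurable (Filter.Eventually.of_forall hC)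
  let N : ℝ → ℝ := fun x => M x * g A - M x * g x
  have hN0 : 0 ≤ᵐ[volume] N := by
    have h1 : ∀ᵐ x : ℝ, x ≠ A := by simp [ae_iff]
    have h2 : ∀ᵐ x : ℝ, x ≠ -A := by simp [ae_iff]
    filter_upwards [h1, h2] with x hx1 hx2
    have hne : |x| ≠ A := by
      intro h
      rcases (abs_eq hA.le).1 h with h | h
      · exact hx1 h
      · exact hx2 h
    change 0 ≤ M x * g A - M x * g x
    rcases lt_or_gt_of_ne hne with h | h
    · have := hin x h
      have := hgw x A (by rwa [abs_of_pos hA])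
      nlinarith
    · have := hout x h
      have := hgw A x (by rwa [abs_of_pos hA])
      nlinarith
  have hNi : ∀ R, IntegrableOn N (Ioc (-R) R) := by
    intro R
    refine Integrable.sub ?_ hMg.integrableOn
    exact ((hMc.mul continuous_const).integrableOn_Icc).mono_set Ioc_subset_Icc_self
  have hpos : 0 < ∫ x in Ioc (-r) r, N x := by
    rw [setIntegral_pos_iff_support_of_nonneg_ae (ae_restrict_of_ae hN0) (hNi r)]
    have hopen : IsOpen ({x | M x < 0} ∩ Ioo 0 r) :=
      (isOpen_lt hMc continuous_const).inter isOpen_Ioo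
    refine lt_of_lt_of_le (hopen.measure_pos volume ⟨p, hp, hp0, hpr⟩) (measure_mono ?_)
    rintro x ⟨hx, hx0, hxr⟩
    refine ⟨?_, by linarith, hxr.le⟩
    have := hrg x (by rwa [abs_of_pos hx0])
    have hx' : M x < 0 := hx
    have : 0 < N x := by change 0 < M x * g A - M x * g x; nlinarith
    exact this.ne'
  have hlim : Tendsto (fun R : ℝ => ∫ x in (-R)..R, M x * g x) atTop (𝓝 (∫ x, M x * g x)) :=
    intervalIntegral_tendsto_integral hMg tendsto_neg_atTop_atBot tendsto_id
  have hle : (∫ x, M x * g x) ≤ -∫ x in Ioc (-r) r, N x := by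
    refine le_of_tendsto hlim ?_
    filter_upwards [eventually_ge_atTop r] with R hR
    have hRpos : 0 < R := by linarith
    have h1 : ∫ x in (-R)..R, N x = (deriv L R - deriv L (-R)) * g A
        - ∫ x in (-R)..R, M x * g x := by
      rw [intervalIntegral.integral_sub, intervalIntegral.integral_mul_const,
        intervalIntegral.integral_deriv_eq_sub]
      · exact fun x _ => hLd1 x
      · exact hMc.intervalIntegrable _ _
      · exact (hMc.mul continuous_const).intervalIntegrable _ _
      · exact hMg.intervalIntegrable
    have h2 : ∫ x in Ioc (-r) r, N x ≤ ∫ x in (-R)..R, N x := by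
      rw [intervalIntegral.integral_of_le (by linarith)]
      exact setIntegral_mono_set (hNi R) (ae_restrict_of_ae hN0)
        (Ioc_subset_Ioc (by linarith) hR).eventuallyLE
    have h3 : (deriv L R - deriv L (-R)) * g A ≤ 0 :=
      mul_nonpos_of_nonpos_of_nonneg (by linarith [hdneg R hRpos, hdpos R hRpos]) (hg0 A)
    linarith
  linarith

theorem integral_second_deriv_neg (f K : ℝ → ℝ) (θ : ℝ)
    (hf : IsPDF f) (hfs : SymmAbout f θ) (hfu : UnimodalAbout f θ)
    (hK : BellShaped K) :
    ∀ h : ℝ, 0 < h → (∫ x, deriv (deriv (Kh K h)) (θ - x) * f x) < 0 := by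
  intro h hh
  obtain ⟨⟨hK0, hKi, hK1⟩, hK2, -, hKu, -, ⟨C, hC⟩, a, ha, hin, hout⟩ := hK
  obtain ⟨hf0, hfi, hf1⟩ := hf
  have hKd : Differentiable ℝ K := hK2.differentiable (by norm_num)
  have hKc1 : ContDiff ℝ 1 (deriv K) := ContDiff.deriv' hK2
  have hKd1 : Differentiable ℝ (deriv K) := hKc1.differentiable (by norm_num)
  have hd1 : deriv (Kh K h) = fun x => deriv K (x / h) / h / h := by
    funext x
    have h1 : HasDerivAt (fun x : ℝ => x / h) (1 / h) x := (hasDerivAt_id x).div_const h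
    have h2 := ((hKd (x / h)).hasDerivAt.comp x h1).div_const h
    have h3 : HasDerivAt (Kh K h) (deriv K (x / h) * (1 / h) / h) x := h2
    rw [h3.deriv, mul_one_div]
  have hd2 : deriv (deriv (Kh K h)) = fun x => deriv (deriv K) (x / h) / h / h / h := by
    rw [hd1]
    funext x
    have h1 : HasDerivAt (fun x : ℝ => x / h) (1 / h) x := (hasDerivAt_id x).div_const h
    have h2 := (((hKd1 (x / h)).hasDerivAt.comp x h1).div_const h).div_const h
    have h3 : HasDerivAt (fun x => deriv K (x / h) / h / h)
      (deriv (deriv K) (x / h) * (1 / h) / h / h) x := h2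
    rw [h3.deriv, mul_one_div]
  have habs : ∀ x : ℝ, |x / h| = |x| / h := fun x => by rw [abs_div, abs_of_pos hh]
  have key := core_neg (Kh K h) (fun u => f (θ - u)) (a * h) (C / h / h / h) ?_ ?_ ?_ ?_ ?_ ?_ ?_
    ?_ ?_ ?_ ?_ ?_
  · have := integral_sub_left_eq_self (fun u => deriv (deriv (Kh K h)) u * f (θ - u)) volume θ
    simp only [sub_sub_cancel] at this
    rw [this]
    exact key
  · unfold Kh
    exact (hK2.comp (contDiff_id.div_const h)).div_const h
  · intro x
    exact div_nonneg (hK0 _) hh.le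
  · by_contra! hcon
    have : K = 0 := by
      funext x
      have := hcon (x * h)
      simpa [Kh, hh.ne'] using this
    simp [this] at hK1
  · intro x y hxy hy
    have hy' : K (y / h) ≠ 0 := by
      intro h0
      exact hy (by simp [Kh, h0])
    have := hKu (x / h) (y / h) (by rw [habs, habs]; gcongr) (by simpa using hy')
    simp only [zero_add] at this
    unfold Kh
    gcongr
  · intro x
    rw [hd2]
    simp only [abs_div, abs_of_pos hh]
    have := hC (x / h)
    gcongr
  · positivity
  · intro x hx
    rw [hd2]
    have := hin (x / h) (by rw [habs]; rwa [div_lt_iff₀ hh])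
    exact div_nonpos_of_nonpos_of_nonneg (div_nonpos_of_nonpos_of_nonneg
      (div_nonpos_of_nonpos_of_nonneg this hh.le) hh.le) hh.le
  · intro x hx
    rw [hd2]
    have := hout (x / h) (by rw [habs]; rwa [lt_div_iff₀ hh])
    positivity
  · exact fun x => hf0 _
  · exact hfi.comp_sub_left θ
  · rw [integral_sub_left_eq_self f volume θ, hf1]
  · intro x y hxy hy
    have := hfu (-x) (-y) (by simpa using hxy) (by simpa [← sub_eq_add_neg] using hy)
    simpa [← sub_eq_add_neg] using this
end
end

section
/- Let f be a pdf symmetric and unimodal about θ that is twice continuously differentiable with bounded f′ and integrable f″. Let K be a bell-shaped kernel satisfying lim_{x→∞} x K(x) = 0 and R(K′) = ∫ K′(x)² dx < ∞. Define σ²_{K,h} = ∫ K_h′(θ−x)² f(x) dx / (∫ K_h″(θ−x) f(x) dx)². Then lim_{h→0⁺} σ²_{K,h} = ∞. Moreover, if f″(θ) < 0 and σ_m² = f(θ) R(K′) / f″(θ)², then σ²_{K,h} / (σ_m² h⁻³) → 1 as h → 0⁺. -/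
open MeasureTheory Real Filter Topology Set

noncomputable section

theorem aux_uni_s4 {f : ℝ → ℝ} {θ : ℝ} (h0 : ∀ x, 0 ≤ f x) (hu : UnimodalAbout f θ) {x y : ℝ}
    (h : |x| < |y|) : f (θ + y) ≤ f (θ + x) := by
  by_cases hy : f (θ + y) = 0
  · rw [hy]; exact h0 _
  · exact (hu x y h hy).le

theorem aux_le {f : ℝ → ℝ} {θ : ℝ} (h0 : ∀ x, 0 ≤ f x) (hu : UnimodalAbout f θ) (x : ℝ) :
    f x ≤ f θ := by
  by_cases hx : x = θ
  · rw [hx]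
  · have := aux_uni_s4 h0 hu (x := 0) (y := x - θ) (by simpa using sub_ne_zero.2 hx)
    simpa using this

theorem aux_pos {f : ℝ → ℝ} {θ : ℝ} (hf : IsPDF f) (hu : UnimodalAbout f θ) : 0 < f θ := by
  obtain ⟨h0, hi, h1⟩ := hf
  rcases (h0 θ).lt_or_eq with h | h
  · exact h
  · have : f = fun _ => 0 := by
      funext x
      exact le_antisymm (h ▸ aux_le h0 hu x) (h0 x)
    rw [this] at h1
    simp at h1

theorem aux_even_s4 {g : ℝ → ℝ} (hc : Continuous g) (he : ∀ x, |g (-x)| = |g x|) {a : ℝ}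
    (hi : IntegrableOn g (Ioi a)) : Integrable g := by
  rw [← integrable_norm_iff hc.aestronglyMeasurable]
  have h1 : IntegrableOn (fun x => ‖g x‖) (Ioi a) := hi.norm
  have h2 : IntegrableOn (fun x => ‖g x‖) (Iio (-a)) := by
    have := (Measure.measurePreserving_neg (volume : Measure ℝ)).integrableOn_comp_preimage
      (MeasurableEquiv.neg ℝ).measurableEmbedding (f := fun x => ‖g x‖) (s := Iio (-a))
    rw [← this]
    have e : (Neg.neg ⁻¹' (Iio (-a)) : Set ℝ) = Ioi a := by ext x; simp
    have e2 : ((fun x => ‖g x‖) ∘ Neg.neg) = fun x => ‖g x‖ := by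
      funext x; simp [Real.norm_eq_abs, he]
    rw [e, e2]; exact h1
  have h3 : IntegrableOn (fun x => ‖g x‖) (Icc (-a) a) :=
    (hc.norm.continuousOn).integrableOn_Icc
  rw [← integrableOn_univ]
  refine ((h1.union h2).union h3).mono_set ?_
  intro x _
  simp only [mem_union, mem_Ioi, mem_Iio, mem_Icc]
  by_cases h : a < x
  · simp [h]
  · by_cases h' : x < -a
    · simp [h']
    · right; constructor <;> linarith

theorem aux_deriv (F : ℝ → ℝ) (h c : ℝ) :
    deriv (fun x => F (x / h) / c) = fun x => deriv F (x / h) / (h * c) := by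
  funext x
  have := deriv_comp_mul_left h⁻¹ F x
  simp only [deriv_div_const]
  have e : (fun x => F (x / h)) = fun x => F (h⁻¹ * x) := by
    funext x; rw [div_eq_inv_mul]
  rw [e, this, div_eq_inv_mul x h, smul_eq_mul, mul_comm h c, div_mul_eq_div_div, div_eq_mul_inv _ h]
  ring

theorem aux_subst (F f : ℝ → ℝ) (θ : ℝ) {h : ℝ} (hh : 0 < h) :
    ∫ x, F ((θ - x) / h) * f x = h * ∫ u, F u * f (θ - h * u) := by
  have h1 := integral_sub_left_eq_self (fun y => F (y / h) * f (θ - y)) (volume : Measure ℝ) θ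
  have h2 := Measure.integral_comp_mul_left (fun y => F (y / h) * f (θ - y)) h
  simp only [sub_sub_cancel] at h1
  rw [h1]
  have e : ∀ u : ℝ, h * u / h = u := fun u => by field_simp
  simp only [e] at h2
  rw [h2, abs_of_pos (inv_pos.2 hh), smul_eq_mul, ← mul_assoc, mul_inv_cancel₀ hh.ne', one_mul]

theorem aux_ibp {K g : ℝ → ℝ} (hK : ContDiff ℝ 2 K) (hg : ContDiff ℝ 2 g)
    (i0 : Integrable K) (i1 : Integrable (deriv K)) (i2 : Integrable (deriv (deriv K)))
    (bK : ∃ C, ∀ x, |K x| ≤ C) (b0 : ∃ C, ∀ x, |g x| ≤ C) (b1 : ∃ C, ∀ x, |deriv g x| ≤ C)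
    (ig : Integrable (deriv (deriv g))) :
    ∫ x, deriv (deriv K) x * g x = ∫ x, K x * deriv (deriv g) x := by
  obtain ⟨CK, bK⟩ := bK
  obtain ⟨C0, b0⟩ := b0
  obtain ⟨C1, b1⟩ := b1
  have dK1 : ContDiff ℝ 1 (deriv K) := ((contDiff_succ_iff_deriv (n := 1)).1 hK).2.2
  have dg1 : ContDiff ℝ 1 (deriv g) := ((contDiff_succ_iff_deriv (n := 1)).1 hg).2.2
  have hK0 : ∀ x, HasDerivAt K (deriv K x) x := fun x =>
    (hK.differentiable (by norm_num) x).hasDerivAt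
  have hg0 : ∀ x, HasDerivAt g (deriv g x) x := fun x =>
    (hg.differentiable (by norm_num) x).hasDerivAt
  have hK1 : ∀ x, HasDerivAt (deriv K) (deriv (deriv K) x) x := fun x =>
    (dK1.differentiable (by norm_num) x).hasDerivAt
  have hg1 : ∀ x, HasDerivAt (deriv g) (deriv (deriv g) x) x := fun x =>
    (dg1.differentiable (by norm_num) x).hasDerivAt
  have mg0 := hg.continuous.aestronglyMeasurable (μ := (volume : Measure ℝ))
  have mg1 := dg1.continuous.aestronglyMeasurable (μ := (volume : Measure ℝ))
  have mK := hK.continuous.aestronglyMeasurable (μ := (volume : Measure ℝ))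
  have B0 : ∀ᵐ x ∂(volume : Measure ℝ), ‖g x‖ ≤ C0 := Eventually.of_forall b0
  have B1 : ∀ᵐ x ∂(volume : Measure ℝ), ‖deriv g x‖ ≤ C1 := Eventually.of_forall b1
  have BK : ∀ᵐ x ∂(volume : Measure ℝ), ‖K x‖ ≤ CK := Eventually.of_forall bK
  have A := integral_mul_deriv_eq_deriv_mul_of_integrable (u := g) (v := deriv K)
    (fun x _ => hg0 x) (fun x _ => hK1 x) (i2.bdd_mul mg0 B0) (i1.bdd_mul mg1 B1)
    (i1.bdd_mul mg0 B0)
  have B := integral_mul_deriv_eq_deriv_mul_of_integrable (u := deriv g) (v := K)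
    (fun x _ => hg1 x) (fun x _ => hK0 x) (i1.bdd_mul mg1 B1) (ig.mul_bdd mK BK)
    (i0.bdd_mul mg1 B1)
  simp only [mul_comm (deriv (deriv K) _), mul_comm (K _)]
  rw [A, B, neg_neg]

theorem aux_kernel {K : ℝ → ℝ} (hK : BellShaped K)
    (hKtail : Tendsto (fun x : ℝ => x * K x) atTop (𝓝 0)) :
    Integrable (deriv K) ∧ Integrable (deriv (deriv K)) ∧ (∃ c, deriv K c ≠ 0) := by
  obtain ⟨hp, hc, hs, hu, -, -, a, ha, -, h2⟩ := hK
  have hs' : (fun x => K (-x)) = K := by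
    funext x; have := hs x; simp at this; exact this.symm
  have o1 : ∀ x, deriv K (-x) = - deriv K x := by
    intro x
    have := deriv_comp_neg K x
    rw [hs'] at this; rw [this, neg_neg]
  have o2 : ∀ x, deriv (deriv K) (-x) = deriv (deriv K) x := by
    intro x
    have := deriv_comp_neg (deriv K) x
    simp only [o1] at this
    have e : deriv (fun x => - deriv K x) x = - deriv (deriv K) x := deriv.fun_neg
    rw [e] at this
    linarith
  have dK1 : ContDiff ℝ 1 (deriv K) := ((contDiff_succ_iff_deriv (n := 1)).1 hc).2.2
  have dK2 : Continuous (deriv (deriv K)) := dK1.continuous_deriv (by norm_num)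
  have hK0 : ∀ x, HasDerivAt K (deriv K x) x := fun x =>
    (hc.differentiable (by norm_num) x).hasDerivAt
  have hK1 : ∀ x, HasDerivAt (deriv K) (deriv (deriv K) x) x := fun x =>
    (dK1.differentiable (by norm_num) x).hasDerivAt
  have anti : AntitoneOn K (Ici 0) := by
    intro x hx y hy hxy
    rcases hxy.lt_or_eq with h | h
    · have := aux_uni_s4 hp.1 hu (x := x) (y := y)
        (by rwa [abs_of_nonneg hx, abs_of_nonneg hy])
      simpa using this
    · rw [h]
  have neg : ∀ x, 0 < x → deriv K x ≤ 0 := by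
    intro x hx
    have := anti.derivWithin_nonpos (x := x)
    rwa [derivWithin_of_mem_nhds (Ici_mem_nhds hx)] at this
  have K0 : Tendsto K atTop (𝓝 0) := by
    have := hKtail.mul tendsto_inv_atTop_zero
    rw [zero_mul] at this
    refine this.congr' ?_
    filter_upwards [eventually_gt_atTop 0] with x hx
    field_simp
  have I1 : Integrable (deriv K) := by
    refine aux_even_s4 dK1.continuous (fun x => by rw [o1, abs_neg]) (a := 0) ?_
    exact integrableOn_Ioi_deriv_of_nonpos' (fun x _ => hK0 x) (fun x hx => neg x hx) K0
  have mono : MonotoneOn (deriv K) (Ici a) := by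
    refine monotoneOn_of_deriv_nonneg (convex_Ici a) dK1.continuous.continuousOn
      (dK1.differentiable (by norm_num)).differentiableOn ?_
    intro x hx
    rw [interior_Ici] at hx
    exact h2 x (lt_of_lt_of_le hx (le_abs_self x))
  have lim : ∃ l, Tendsto (deriv K) atTop (𝓝 l) := by
    have m : Monotone (fun x => deriv K (max x a)) := fun x y hxy =>
      mono (mem_Ici.2 (le_max_right _ _)) (mem_Ici.2 (le_max_right _ _)) (max_le_max_right a hxy)
    have b : BddAbove (range (fun x => deriv K (max x a))) := by
      refine ⟨0, ?_⟩
      rintro _ ⟨x, rfl⟩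
      exact neg _ (lt_of_lt_of_le ha (le_max_right _ _))
    refine ⟨_, (tendsto_atTop_ciSup m b).congr' ?_⟩
    filter_upwards [eventually_ge_atTop a] with x hx
    rw [max_eq_left hx]
  obtain ⟨l, lim⟩ := lim
  have I2 : Integrable (deriv (deriv K)) := by
    refine aux_even_s4 dK2 (fun x => by rw [o2]) (a := a) ?_
    exact integrableOn_Ioi_deriv_of_nonneg' (fun x _ => hK1 x)
      (fun x hx => h2 x (lt_of_lt_of_le hx (le_abs_self x))) lim
  refine ⟨I1, I2, ?_⟩
  by_contra hcon
  push Not at hcon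
  have p0 := aux_pos hp hu
  have cst : ∀ x, K x = K 0 := fun x =>
    is_const_of_deriv_eq_zero (hc.differentiable (by norm_num)) hcon x 0
  have := hu 0 1 (by simp) (by rw [cst]; exact p0.ne')
  rw [cst (0 + 1), cst (0 + 0)] at this
  exact lt_irrefl _ this

theorem aux_strict {K : ℝ → ℝ} (hp : IsPDF K) (hc : ContDiff ℝ 2 K) (hs : SymmAbout K 0)
    (hu : UnimodalAbout K 0) {a : ℝ} (ha : 0 < a) :
    ∃ d, 0 < d ∧ d < a ∧ deriv (deriv K) d ≠ 0 := by
  have hs' : (fun x => K (-x)) = K := by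
    funext x; have := hs x; simp at this; exact this.symm
  have o1 : deriv K 0 = 0 := by
    have := deriv_comp_neg K 0
    rw [hs', neg_zero] at this; linarith
  have dK1 : ContDiff ℝ 1 (deriv K) := ((contDiff_succ_iff_deriv (n := 1)).1 hc).2.2
  have p0 := aux_pos hp hu
  have ev : ∀ᶠ x in 𝓝[>] (0 : ℝ), 0 < K x ∧ x < a := by
    refine Filter.Eventually.and ?_ ?_
    · exact (hc.continuous.continuousAt.eventually_const_lt p0).filter_mono nhdsWithin_le_nhds
    · exact (eventually_lt_nhds ha).filter_mono nhdsWithin_le_nhds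
  obtain ⟨b, ⟨hb1, hb2⟩, hb0⟩ := (ev.and self_mem_nhdsWithin).exists
  have hb0 : 0 < b := hb0
  have hlt := hu 0 b (by simpa using hb0.ne') (by simpa using hb1.ne')
  simp only [zero_add] at hlt
  obtain ⟨c, hc1, hc2⟩ := exists_deriv_eq_slope K hb0 hc.continuous.continuousOn
    (hc.differentiable (by norm_num)).differentiableOn
  have hcn : deriv K c < 0 := by
    rw [hc2]; apply div_neg_of_neg_of_pos <;> linarith
  obtain ⟨d, hd1, hd2⟩ := exists_deriv_eq_slope (deriv K) hc1.1 dK1.continuous.continuousOn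
    (dK1.differentiable (by norm_num)).differentiableOn
  refine ⟨d, hd1.1, by linarith [hd1.2, hc1.2], ?_⟩
  rw [hd2, o1]
  apply ne_of_lt
  apply div_neg_of_neg_of_pos <;> linarith [hc1.1]

theorem aux_neg {K f : ℝ → ℝ} {θ : ℝ} (hf : IsPDF f) (hfs : SymmAbout f θ)
    (hfu : UnimodalAbout f θ) (hfc : Continuous f) (hK : BellShaped K)
    (hKtail : Tendsto (fun x : ℝ => x * K x) atTop (𝓝 0)) :
    ∀ᶠ h in 𝓝[>] (0 : ℝ), ∫ u, deriv (deriv K) u * f (θ - h * u) < 0 := by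
  obtain ⟨I1, I2, -⟩ := aux_kernel hK hKtail
  obtain ⟨hp, hc, hs, hu, -, -, a, ha, h1, h2⟩ := hK
  obtain ⟨d, hd0, hda, hd⟩ := aux_strict hp hc hs hu ha
  have dK1 : ContDiff ℝ 1 (deriv K) := ((contDiff_succ_iff_deriv (n := 1)).1 hc).2.2
  have dK2 : Continuous (deriv (deriv K)) := dK1.continuous_deriv (by norm_num)
  have hK1 : ∀ x, HasDerivAt (deriv K) (deriv (deriv K) x) x := fun x =>
    (dK1.differentiable (by norm_num) x).hasDerivAt
  have Z := integral_eq_zero_of_hasDerivAt_of_integrable hK1 I2 I1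
  have p0 := aux_pos hf hfu
  have ev : ∀ᶠ h in 𝓝[>] (0 : ℝ), 0 < f (θ + h * a) := by
    have hcont : ContinuousAt (fun h : ℝ => f (θ + h * a)) 0 := by fun_prop
    exact (hcont.eventually_const_lt (u := 0) (by simpa using p0)).filter_mono nhdsWithin_le_nhds
  filter_upwards [ev, self_mem_nhdsWithin] with h hpos hh
  have hh : 0 < h := hh
  have bd : ∀ᵐ u ∂(volume : Measure ℝ), ‖f (θ - h * u)‖ ≤ f θ :=
    Eventually.of_forall fun u => by
      rw [Real.norm_eq_abs, abs_of_nonneg (hf.1 _)]; exact aux_le hf.1 hfu _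
  have J : Integrable (fun u => deriv (deriv K) u * f (θ - h * u)) :=
    I2.mul_bdd (by
      have : Continuous fun u => f (θ - h * u) := by fun_prop
      exact this.aestronglyMeasurable) bd
  have J2 : Integrable (fun u => deriv (deriv K) u * f (θ + h * a)) := I2.mul_const _
  have key : 0 < ∫ u, (deriv (deriv K) u * f (θ + h * a) - deriv (deriv K) u * f (θ - h * u)) := by
    refine integral_pos_of_integrable_nonneg_nonzero (x := d) (by fun_prop) (J2.sub J) ?_ ?_
    · intro u
      simp only [Pi.zero_apply]
      rw [← mul_sub]
      rcases lt_trichotomy |u| a with hua | hua | hua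
      · apply mul_nonneg_of_nonpos_of_nonpos (h1 u hua)
        have := aux_uni_s4 hf.1 hfu (x := -(h * u)) (y := h * a) (by
          rw [abs_neg, abs_mul, abs_mul, abs_of_pos hh, abs_of_pos ha]
          exact mul_lt_mul_of_pos_left hua hh)
        rw [← sub_eq_add_neg] at this
        linarith
      · have : f (θ - h * u) = f (θ + h * a) := by
          rcases (abs_eq ha.le).1 hua with e | e
          · rw [e, hfs]
          · rw [e]; congr 1; ring
        rw [this]; simp
      · apply mul_nonneg (h2 u hua)
        have := aux_uni_s4 hf.1 hfu (x := h * a) (y := -(h * u)) (by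
          rw [abs_neg, abs_mul, abs_mul, abs_of_pos hh, abs_of_pos ha]
          exact mul_lt_mul_of_pos_left hua hh)
        rw [← sub_eq_add_neg] at this
        linarith
    · rw [← mul_sub]
      apply mul_ne_zero hd
      have := hfu (-(h * d)) (h * a) (by
          rw [abs_neg, abs_mul, abs_mul, abs_of_pos hh, abs_of_pos ha, abs_of_pos hd0]
          exact mul_lt_mul_of_pos_left hda hh) hpos.ne'
      rw [← sub_eq_add_neg] at this
      linarith
  rw [integral_sub J2 J, integral_mul_const, Z] at key
  linarith

theorem aux_D {K f : ℝ → ℝ} {θ : ℝ} (hf : IsPDF f)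
    (hfu : UnimodalAbout f θ) (hf2 : ContDiff ℝ 2 f)
    (hf'bdd : ∃ C, ∀ x, |deriv f x| ≤ C) (hf''int : Integrable (deriv (deriv f)))
    (hK : BellShaped K)
    (hKtail : Tendsto (fun x : ℝ => x * K x) atTop (𝓝 0)) {h : ℝ} (hh : 0 < h) :
    ∫ u, deriv (deriv K) u * f (θ - h * u) = h ^ 2 * ∫ u, K u * deriv (deriv f) (θ - h * u) := by
  obtain ⟨I1, I2, -⟩ := aux_kernel hK hKtail
  obtain ⟨hp, hc, hs, hu, -, -, -⟩ := hK
  obtain ⟨C, hC⟩ := hf'bdd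
  have comp : ∀ F : ℝ → ℝ, deriv (fun u => F (θ - h * u)) = fun u => -h * deriv F (θ - h * u) := by
    intro F
    funext u
    have := deriv_comp_mul_left h (fun y => F (θ - y)) u
    rw [this, deriv_comp_const_sub]
    simp
  have e1 := comp f
  have e2 : deriv (deriv (fun u => f (θ - h * u))) =
      fun u => h ^ 2 * deriv (deriv f) (θ - h * u) := by
    rw [e1]
    funext u
    rw [deriv_const_mul_field, comp]
    ring
  have ii : Integrable (fun u => deriv (deriv f) (θ - h * u)) :=
    (hf''int.comp_sub_left θ).comp_mul_left' hh.ne'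
  have := aux_ibp (g := fun u => f (θ - h * u)) hc
    (hf2.comp (by fun_prop)) hp.2.1 I1 I2
    ⟨K 0, fun x => by rw [abs_of_nonneg (hp.1 x)]; exact aux_le hp.1 hu x⟩
    ⟨f θ, fun x => by rw [abs_of_nonneg (hf.1 _)]; exact aux_le hf.1 hfu _⟩
    ⟨h * C, fun x => by
      rw [e1, abs_mul, abs_neg, abs_of_pos hh]
      exact mul_le_mul_of_nonneg_left (hC _) hh.le⟩
    (by rw [e2]; exact ii.const_mul _)
  rw [this, e2, ← integral_const_mul]
  congr 1
  funext u
  ring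

theorem aux_lim {K f : ℝ → ℝ} {θ : ℝ} (hf2 : ContDiff ℝ 2 f)
    (hf''int : Integrable (deriv (deriv f)))
    (hK : BellShaped K)
    (hKtail : Tendsto (fun x : ℝ => x * K x) atTop (𝓝 0)) :
    Tendsto (fun h => ∫ u, K u * deriv (deriv f) (θ - h * u)) (𝓝[>] 0)
      (𝓝 (deriv (deriv f) θ)) := by
  obtain ⟨hp, hc, hs, hu, -, -, -⟩ := hK
  have df1 : ContDiff ℝ 1 (deriv f) := ((contDiff_succ_iff_deriv (n := 1)).1 hf2).2.2
  have df2 : Continuous (deriv (deriv f)) := df1.continuous_deriv (by norm_num)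
  have hs' : ∀ x, K (-x) = K x := by
    intro x; have := hs x; simp at this; exact this.symm
  have tail : Tendsto (fun x : ℝ => ‖x‖ ^ Module.finrank ℝ ℝ * K x) (Bornology.cobounded ℝ) (𝓝 0) := by
    rw [IsOrderBornology.cobounded_eq]
    have top : Tendsto (fun x : ℝ => ‖x‖ ^ Module.finrank ℝ ℝ * K x) atTop (𝓝 0) := by
      refine hKtail.congr' ?_
      filter_upwards [eventually_ge_atTop 0] with x hx
      simp [abs_of_nonneg hx]
    refine Tendsto.sup ?_ top
    have := top.comp tendsto_neg_atBot_atTop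
    refine this.congr fun x => ?_
    simp [hs']
  have main := tendsto_integral_comp_smul_smul_of_integrable' (μ := volume) hp.1 hp.2.2 tail
    hf''int (x₀ := θ) df2.continuousAt
  refine (main.comp tendsto_inv_nhdsGT_zero).congr' ?_
  filter_upwards [self_mem_nhdsWithin] with h hh
  have hh : 0 < h := hh
  have := aux_subst K (deriv (deriv f)) θ hh
  have e : ∫ u, K u * deriv (deriv f) (θ - h * u) =
      h⁻¹ * ∫ x, K ((θ - x) / h) * deriv (deriv f) x := by
    rw [this, ← mul_assoc, inv_mul_cancel₀ hh.ne', one_mul]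
  rw [e, ← integral_const_mul]
  simp only [Function.comp_apply, Module.finrank_self, pow_one, smul_eq_mul, div_eq_inv_mul,
    mul_assoc]

theorem aux_N {K f : ℝ → ℝ} {θ : ℝ} (hf : IsPDF f)
    (hfu : UnimodalAbout f θ) (hfc : Continuous f)
    (hRK' : Integrable (fun x : ℝ => (deriv K x) ^ 2)) :
    Tendsto (fun h => ∫ u, (deriv K u) ^ 2 * f (θ - h * u)) (𝓝[>] 0)
      (𝓝 (f θ * ∫ x, (deriv K x) ^ 2)) := by
  have e : f θ * ∫ x, (deriv K x) ^ 2 = ∫ x, (deriv K x) ^ 2 * f θ := by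
    rw [integral_mul_const, mul_comm]
  rw [e]
  refine tendsto_integral_filter_of_dominated_convergence (fun u => (deriv K u) ^ 2 * f θ) ?_ ?_
    (hRK'.mul_const _) ?_
  · refine Eventually.of_forall fun h => ?_
    have : Continuous fun u => f (θ - h * u) := by fun_prop
    exact hRK'.aestronglyMeasurable.mul this.aestronglyMeasurable
  · refine Eventually.of_forall fun h => Eventually.of_forall fun u => ?_
    rw [Real.norm_eq_abs, abs_of_nonneg (mul_nonneg (sq_nonneg _) (hf.1 _))]
    exact mul_le_mul_of_nonneg_left (aux_le hf.1 hfu _) (sq_nonneg _)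
  · refine Eventually.of_forall fun u => ?_
    have hcont : Continuous (fun h : ℝ => (deriv K u) ^ 2 * f (θ - h * u)) := by fun_prop
    have := hcont.tendsto 0
    simp only [zero_mul, sub_zero] at this
    exact this.mono_left nhdsWithin_le_nhds

theorem aux_var {K f : ℝ → ℝ} {θ : ℝ} {h : ℝ} (hh : 0 < h)
    (hD : ∫ u, deriv (deriv K) u * f (θ - h * u) =
      h ^ 2 * ∫ u, K u * deriv (deriv f) (θ - h * u)) :
    asympVar K f θ h = (∫ u, (deriv K u) ^ 2 * f (θ - h * u)) /
      (∫ u, K u * deriv (deriv f) (θ - h * u)) ^ 2 * (h ^ 3)⁻¹ := by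
  have e0 : Kh K h = fun x => K (x / h) / h := rfl
  have e1 : deriv (Kh K h) = fun x => deriv K (x / h) / (h * h) := by
    rw [e0, aux_deriv]
  have e2 : deriv (deriv (Kh K h)) = fun x => deriv (deriv K) (x / h) / (h * (h * h)) := by
    rw [e1, aux_deriv]
  have n : ∫ x, (deriv (Kh K h) (θ - x)) ^ 2 * f x =
      (h ^ 3)⁻¹ * ∫ u, (deriv K u) ^ 2 * f (θ - h * u) := by
    have := aux_subst (fun u => (deriv K u) ^ 2) f θ hh
    have e : (h ^ 3)⁻¹ = (h ^ 4)⁻¹ * h := by field_simp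
    rw [e, mul_assoc, ← this, ← integral_const_mul, e1]
    congr 1
    funext x
    field_simp
  have m : ∫ x, deriv (deriv (Kh K h)) (θ - x) * f x =
      ∫ u, K u * deriv (deriv f) (θ - h * u) := by
    have := aux_subst (deriv (deriv K)) f θ hh
    rw [hD] at this
    have e : ∫ u, K u * deriv (deriv f) (θ - h * u) =
        (h ^ 3)⁻¹ * ∫ x, deriv (deriv K) ((θ - x) / h) * f x := by
      rw [this]; field_simp
    rw [e, ← integral_const_mul, e2]
    congr 1
    funext x
    field_simp
  rw [asympVar, n, m]
  ring

theorem asympVar_bandwidth_to_zero (f K : ℝ → ℝ) (θ : ℝ)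
    (hf : IsPDF f) (hfs : SymmAbout f θ) (hfu : UnimodalAbout f θ)
    (hf2 : ContDiff ℝ 2 f)
    (hf'bdd : ∃ C, ∀ x, |deriv f x| ≤ C)
    (hf''int : MeasureTheory.Integrable (deriv (deriv f)))
    (hK : BellShaped K)
    (hKtail : Tendsto (fun x : ℝ => x * K x) atTop (𝓝 0))
    (hRK' : MeasureTheory.Integrable (fun x : ℝ => (deriv K x) ^ 2)) :
    Tendsto (fun h : ℝ => asympVar K f θ h) (𝓝[>] 0) atTop ∧
      (deriv (deriv f) θ < 0 →
        Tendsto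
          (fun h : ℝ => asympVar K f θ h /
            ((f θ * (∫ x, (deriv K x) ^ 2) / (deriv (deriv f) θ) ^ 2) / h ^ 3))
          (𝓝[>] 0) (𝓝 1)) := by
  have hfc := hf2.continuous
  obtain ⟨-, -, c, hcK⟩ := aux_kernel hK hKtail
  have dK1 : ContDiff ℝ 1 (deriv K) := ((contDiff_succ_iff_deriv (n := 1)).1 hK.2.1).2.2
  have hR : 0 < ∫ x, (deriv K x) ^ 2 :=
    integral_pos_of_integrable_nonneg_nonzero (x := c) (dK1.continuous.pow 2) hRK'
      (fun x => sq_nonneg _) (pow_ne_zero 2 hcK)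
  have hfθ := aux_pos hf hfu
  have hfR := mul_pos hfθ hR
  have LN := aux_N (K := K) hf hfu hfc hRK'
  have LD := aux_lim (θ := θ) hf2 hf''int hK hKtail
  have hD : ∀ h : ℝ, 0 < h → _ := fun h hh =>
    aux_D (θ := θ) hf hfu hf2 hf'bdd hf''int hK hKtail hh
  have hneg := aux_neg hf hfs hfu hfc hK hKtail
  constructor
  · have hcube : Tendsto (fun h : ℝ => (h ^ 3)⁻¹) (𝓝[>] 0) atTop := by
      have := (tendsto_pow_atTop (α := ℝ) (n := 3) (by norm_num)).comp
        (tendsto_inv_nhdsGT_zero (𝕜 := ℝ))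
      refine this.congr fun h => ?_
      simp
    set M := (deriv (deriv f) θ) ^ 2 + 1 with hM
    have hMpos : 0 < M := by positivity
    set A := f θ * ∫ x, (deriv K x) ^ 2 with hA
    refine tendsto_atTop_mono' _ ?_ (hcube.const_mul_atTop (r := A / 2 / M) (by positivity))
    filter_upwards [self_mem_nhdsWithin, hneg, LN.eventually_const_lt (half_lt_self hfR),
      (LD.pow 2).eventually_lt_const (lt_add_one _)] with h hh h1 h2 h3
    have hh : 0 < h := hh
    rw [aux_var hh (hD h hh)]
    rw [hD h hh] at h1
    refine mul_le_mul_of_nonneg_right ?_ (by positivity)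
    have hne : (∫ u, K u * deriv (deriv f) (θ - h * u)) ≠ 0 := by
      intro h0
      rw [h0] at h1
      simp at h1
    have hpos : 0 < (∫ u, K u * deriv (deriv f) (θ - h * u)) ^ 2 := by positivity
    exact div_le_div₀ (by linarith) h2.le hpos h3.le
  · intro hlt
    have hne : (deriv (deriv f) θ) ^ 2 ≠ 0 := pow_ne_zero 2 hlt.ne
    have L := (LN.div (LD.pow 2) hne).div_const
      (f θ * (∫ x, (deriv K x) ^ 2) / (deriv (deriv f) θ) ^ 2)
    rw [div_self (div_ne_zero hfR.ne' hne)] at L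
    refine L.congr' ?_
    filter_upwards [self_mem_nhdsWithin] with h hh
    have hh : 0 < h := hh
    rw [aux_var hh (hD h hh)]
    simp only [Pi.div_apply]
    generalize (f θ * (∫ x, (deriv K x) ^ 2) / (deriv (deriv f) θ) ^ 2) = B
    rw [div_div_eq_mul_div, mul_assoc, inv_mul_cancel₀ (by positivity), mul_one]
end
end

section
/- Let f be a pdf symmetric and unimodal about θ with finite variance σ² = ∫ (x−θ)² f(x) dx, and let K be a bell-shaped kernel with K″(0) < 0. Define σ²_{K,h} = ∫ K_h′(θ−x)² f(x) dx / (∫ K_h″(θ−x) f(x) dx)². Then lim_{h→∞} σ²_{K,h} = σ². -/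
open MeasureTheory Real Filter Topology Set

noncomputable section

theorem asympVar_bandwidth_to_infty (f K : ℝ → ℝ) (θ : ℝ)
    (hf : IsPDF f) (hfs : SymmAbout f θ) (hfu : UnimodalAbout f θ)
    (hvar : MeasureTheory.Integrable (fun x : ℝ => (x - θ) ^ 2 * f x))
    (hK : BellShaped K) (hK''0 : deriv (deriv K) 0 < 0) :
    Tendsto (fun h : ℝ => asympVar K f θ h) atTop
      (𝓝 (∫ x, (x - θ) ^ 2 * f x)) := by
  obtain ⟨hf0, hfi, hf1⟩ := hf
  obtain ⟨-, hKc, hKs, -, -, ⟨C, hC⟩, -⟩ := hK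
  have hKd : Differentiable ℝ K := hKc.differentiable (by norm_num)
  have hK1 : ContDiff ℝ 1 (deriv K) := by
    have h2 : ContDiff ℝ (1 + 1) K := by simpa [one_add_one_eq_two] using hKc
    exact (contDiff_succ_iff_deriv.1 h2).2.2
  have hK1d : Differentiable ℝ (deriv K) := hK1.differentiable (by norm_num)
  have hK2c : Continuous (deriv (deriv K)) := hK1.continuous_deriv (by norm_num)
  have hK0 : deriv K 0 = 0 := by
    have e : (fun x => K (-x)) = K := by
      funext x
      have := hKs x
      simp at this
      exact this.symm
    have h3 := deriv_comp_neg K 0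
    rw [e] at h3
    simp at h3
    linarith
  have hb : ∀ y, |deriv K y| ≤ C * |y| := by
    intro y
    have := Convex.norm_image_sub_le_of_norm_deriv_le (f := deriv K) (s := univ) (C := C)
      (x := 0) (y := y) (fun x _ => hK1d x) (fun x _ => by simpa using hC x) convex_univ
      (mem_univ _) (mem_univ _)
    simpa [hK0] using this
  have d1 : ∀ h : ℝ, deriv (Kh K h) = fun x => deriv K (x / h) / h / h := by
    intro h
    funext x
    have h1 : HasDerivAt (fun x : ℝ => K (x / h) / h) (deriv K (x / h) * (1 / h) / h) x :=
      ((hKd (x / h)).hasDerivAt.comp x ((hasDerivAt_id x).div_const h)).div_const h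
    have h2 : deriv (Kh K h) x = _ := h1.deriv
    rw [h2]; ring
  have d2 : ∀ h : ℝ, deriv (deriv (Kh K h)) = fun x => deriv (deriv K) (x / h) / h / h / h := by
    intro h
    rw [d1]
    funext x
    have h1 : HasDerivAt (fun x : ℝ => deriv K (x / h) / h / h)
        (deriv (deriv K) (x / h) * (1 / h) / h / h) x :=
      ((HasDerivAt.comp (h₂ := deriv K) x (hK1d (x / h)).hasDerivAt
        ((hasDerivAt_id x).div_const h)).div_const h).div_const h
    rw [h1.deriv]; ring
  have hN : Tendsto (fun h : ℝ => ∫ x, (h * deriv K ((θ - x) / h)) ^ 2 * f x) atTop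
      (𝓝 (∫ x, (deriv (deriv K) 0 * (θ - x)) ^ 2 * f x)) := by
    apply tendsto_integral_filter_of_dominated_convergence
      (fun x => C ^ 2 * ((x - θ) ^ 2 * f x))
    · refine Eventually.of_forall fun h => ?_
      have hc : Continuous fun x => (h * deriv K ((θ - x) / h)) ^ 2 := by
        have := hK1.continuous
        fun_prop
      exact hc.aestronglyMeasurable.mul hfi.aestronglyMeasurable
    · filter_upwards [eventually_gt_atTop 0] with h hh
      refine Eventually.of_forall fun x => ?_
      have h1 : |h * deriv K ((θ - x) / h)| ≤ C * |x - θ| := by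
        rw [abs_mul, abs_of_pos hh]
        calc h * |deriv K ((θ - x) / h)| ≤ h * (C * |(θ - x) / h|) := by gcongr; exact hb _
          _ = C * |x - θ| := by
            rw [abs_div, abs_of_pos hh, abs_sub_comm]; field_simp
      have h2 := pow_le_pow_left₀ (abs_nonneg _) h1 2
      rw [sq_abs, mul_pow C, sq_abs] at h2
      rw [Real.norm_eq_abs, abs_of_nonneg (mul_nonneg (sq_nonneg _) (hf0 x)), ← mul_assoc]
      exact mul_le_mul_of_nonneg_right h2 (hf0 x)
    · exact hvar.const_mul _
    · refine Eventually.of_forall fun x => ?_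
      have h1 : HasDerivAt (fun t : ℝ => deriv K (t * (θ - x)))
          (deriv (deriv K) 0 * (θ - x)) 0 := by
        have h0 : HasDerivAt (fun t : ℝ => t * (θ - x)) (θ - x) 0 := by
          simpa using (hasDerivAt_id (0:ℝ)).mul_const (θ - x)
        have h3 : HasDerivAt (deriv K) (deriv (deriv K) 0) (0 * (θ - x)) := by
          rw [zero_mul]; exact (hK1d 0).hasDerivAt
        exact h3.comp 0 h0
      have h2 := h1.tendsto_slope_zero
      have h3 : Tendsto (fun h : ℝ => h⁻¹) atTop (𝓝[≠] 0) :=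
        tendsto_inv_atTop_nhdsGT_zero.mono_right (nhdsWithin_mono _ fun y hy => ne_of_gt hy)
      have h4 := h2.comp h3
      have h5 : Tendsto (fun h : ℝ => h * deriv K ((θ - x) / h)) atTop
          (𝓝 (deriv (deriv K) 0 * (θ - x))) := by
        refine h4.congr fun h => ?_
        simp [hK0, div_eq_inv_mul]
      exact (h5.pow 2).mul_const _
  have hD : Tendsto (fun h : ℝ => ∫ x, deriv (deriv K) ((θ - x) / h) * f x) atTop
      (𝓝 (∫ x, deriv (deriv K) 0 * f x)) := by
    apply tendsto_integral_filter_of_dominated_convergence (fun x => C * f x)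
    · refine Eventually.of_forall fun h => ?_
      have hc : Continuous fun x => deriv (deriv K) ((θ - x) / h) := by fun_prop
      exact hc.aestronglyMeasurable.mul hfi.aestronglyMeasurable
    · refine Eventually.of_forall fun h => Eventually.of_forall fun x => ?_
      rw [norm_mul, Real.norm_eq_abs, Real.norm_eq_abs, abs_of_nonneg (hf0 x)]
      exact mul_le_mul_of_nonneg_right (hC _) (hf0 x)
    · exact hfi.const_mul _
    · refine Eventually.of_forall fun x => ?_
      have h1 : Tendsto (fun h : ℝ => (θ - x) / h) atTop (𝓝 0) :=
        tendsto_const_nhds.div_atTop tendsto_id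
      exact ((hK2c.tendsto 0).comp h1).mul_const _
  rw [integral_const_mul, hf1, mul_one] at hD
  have hN2 : (∫ x, (deriv (deriv K) 0 * (θ - x)) ^ 2 * f x)
      = (deriv (deriv K) 0) ^ 2 * ∫ x, (x - θ) ^ 2 * f x := by
    rw [← integral_const_mul]
    congr 1; funext x; ring
  rw [hN2] at hN
  have hne : (deriv (deriv K) 0) ^ 2 ≠ 0 := pow_ne_zero _ hK''0.ne
  have hfin := hN.div (hD.pow 2) hne
  rw [mul_div_cancel_left₀ _ hne] at hfin
  refine hfin.congr' ?_
  filter_upwards [eventually_gt_atTop 0] with h hh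
  have e1 : (∫ x, (h * deriv K ((θ - x) / h)) ^ 2 * f x)
      = h ^ 6 * ∫ x, (deriv (Kh K h) (θ - x)) ^ 2 * f x := by
    rw [← integral_const_mul, d1]
    congr 1; funext x; field_simp
  have e2 : (∫ x, deriv (deriv K) ((θ - x) / h) * f x)
      = h ^ 3 * ∫ x, deriv (deriv (Kh K h)) (θ - x) * f x := by
    rw [← integral_const_mul, d2]
    congr 1; funext x; field_simp
  simp only [Pi.div_apply, Pi.pow_apply, asympVar]
  rw [e1, e2, mul_pow, ← pow_mul]
  exact mul_div_mul_left _ _ (by positivity)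
end
end

section
/- Let f be a pdf symmetric and unimodal about θ such that f₀(x) = f(θ+x) is regularly varying at infinity with index α < −3, with representation f₀(x) = x^α L(x) where L is bounded, slowly varying, and satisfies lim_{h→∞} L(h) = ℓ > 0; suppose f has finite variance σ². Let K be a bell-shaped kernel with K″(0) < 0 such that I_{K,α} = ∫₀^∞ x^α [|K″(0)|⁻² K′(x)² − x²] dx is finite and negative, and ∫₀^∞ x^α [1 + |K″(0)|⁻¹ K″(x)] dx is finite. Then, with σ²_{K,h} = ∫ K_h′(θ−x)² f(x) dx / (∫ K_h″(θ−x) f(x) dx)², one has lim_{h→∞} h^{−(α+3)} (σ²_{K,h} − σ²) = 2ℓ I_{K,α}; consequently σ²_{K,h} < σ² for every sufficiently large h. -/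
open MeasureTheory Real Filter Topology Set

noncomputable section

theorem aux_lim_s7 (f L G : ℝ → ℝ) (θ α ℓ : ℝ)
    (hf : Integrable f) (hfs : SymmAbout f θ)
    (hrep : ∀ x : ℝ, 0 < x → f (θ + x) = x ^ α * L x)
    (hLbdd : ∃ C, ∀ x, |L x| ≤ C)
    (hLlim : Tendsto L atTop (𝓝 ℓ))
    (hGc : Continuous G) (hGe : ∀ x, G (-x) = G x)
    (hG : IntegrableOn (fun x : ℝ => x ^ α * G x) (Set.Ioi 0)) :
    Tendsto (fun h : ℝ => h ^ (-(α + 1)) * ∫ x, G ((θ - x) / h) * f x) atTop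
      (𝓝 (2 * ℓ * ∫ x in Set.Ioi (0 : ℝ), x ^ α * G x)) := by
  obtain ⟨C, hC⟩ := hLbdd
  have key : ∀ h : ℝ, 0 < h → h ^ (-(α + 1)) * ∫ x, G ((θ - x) / h) * f x
      = 2 * ∫ v in Set.Ioi (0 : ℝ), h ^ (-α) * (G v * f (θ + h * v)) := by
    intro h hh
    have e1 : ∫ x, G ((θ - x) / h) * f x = ∫ u, G (u / h) * f (θ - u) := by
      have := integral_sub_left_eq_self (fun u => G (u / h) * f (θ - u)) volume θ
      rw [← this]
      simp
    have e2 : ∫ u, G (u / h) * f (θ - u) = h * ∫ v, G v * f (θ - h * v) := by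
      have := Measure.integral_comp_div (fun v => G v * f (θ - h * v)) h
      rw [abs_of_pos hh, smul_eq_mul] at this
      rw [← this]
      congr 1
      ext u
      rw [mul_div_cancel₀ _ hh.ne']
    have e3 : ∫ v, G v * f (θ - h * v) = 2 * ∫ v in Set.Ioi (0 : ℝ), G v * f (θ + h * v) := by
      rw [← integral_comp_abs (f := fun v => G v * f (θ + h * v))]
      congr 1
      ext v
      rcases abs_cases v with ⟨h1, _⟩ | ⟨h1, _⟩
      · rw [h1, hfs]
      · rw [h1, hGe]
        congr 2
        ring
    have e4 : h ^ (-(α + 1)) * h = h ^ (-α) := by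
      rw [← Real.rpow_add_one hh.ne']
      congr 1
      ring
    rw [e1, e2, e3, integral_const_mul, ← e4]
    ring
  have keyv : ∀ h : ℝ, 0 < h → ∀ v : ℝ, 0 < v →
      h ^ (-α) * (G v * f (θ + h * v)) = v ^ α * G v * L (h * v) := by
    intro h hh v hv
    rw [hrep _ (mul_pos hh hv), Real.mul_rpow hh.le hv.le]
    have : h ^ (-α) * h ^ α = 1 := by
      rw [← Real.rpow_add hh]; simp
    linear_combination (G v * v ^ α * L (h * v)) * this
  have dct : Tendsto (fun h : ℝ => ∫ v in Set.Ioi (0 : ℝ), h ^ (-α) * (G v * f (θ + h * v))) atTop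
      (𝓝 (∫ v in Set.Ioi (0 : ℝ), v ^ α * G v * ℓ)) := by
    apply tendsto_integral_filter_of_dominated_convergence (fun v => ‖v ^ α * G v‖ * C)
    · filter_upwards [eventually_gt_atTop 0] with h hh
      have h1 : Integrable (fun v => f (θ + h * v)) :=
        (hf.comp_add_left θ).comp_mul_left' hh.ne'
      exact ((hGc.aestronglyMeasurable.mul h1.aestronglyMeasurable).const_mul _).restrict
    · filter_upwards [eventually_gt_atTop 0] with h hh
      filter_upwards [ae_restrict_mem measurableSet_Ioi] with v hv
      rw [keyv h hh v hv, norm_mul]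
      exact mul_le_mul_of_nonneg_left (hC _) (norm_nonneg _)
    · exact hG.norm.mul_const C
    · filter_upwards [ae_restrict_mem measurableSet_Ioi] with v hv
      have hv' : (0 : ℝ) < v := hv
      have h1 : Tendsto (fun h : ℝ => v ^ α * G v * L (h * v)) atTop (𝓝 (v ^ α * G v * ℓ)) :=
        (hLlim.comp (tendsto_id.atTop_mul_const hv')).const_mul _
      refine h1.congr' ?_
      filter_upwards [eventually_gt_atTop 0] with h hh
      exact (keyv h hh v hv).symm
  have := dct.const_mul 2
  rw [integral_mul_const] at this
  have e : 2 * ((∫ v in Set.Ioi (0 : ℝ), v ^ α * G v) * ℓ)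
      = 2 * ℓ * ∫ x in Set.Ioi (0 : ℝ), x ^ α * G x := by ring
  rw [e] at this
  refine this.congr' ?_
  filter_upwards [eventually_gt_atTop 0] with h hh
  exact (key h hh).symm

theorem aux_dKh (K : ℝ → ℝ) (h x : ℝ) :
    deriv (Kh K h) x = deriv K (x / h) / h ^ 2 := by
  have : Kh K h = fun x => K (x / h) / h := rfl
  rw [this, deriv_div_const]
  simp only [div_eq_inv_mul]
  rw [deriv_comp_mul_left, smul_eq_mul]
  ring

theorem aux_ddKh (K : ℝ → ℝ) (h x : ℝ) :
    deriv (deriv (Kh K h)) x = deriv (deriv K) (x / h) / h ^ 3 := by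
  have : deriv (Kh K h) = fun x => deriv K (x / h) / h ^ 2 := funext (aux_dKh K h)
  rw [this, deriv_div_const]
  simp only [div_eq_inv_mul]
  rw [deriv_comp_mul_left, smul_eq_mul]
  ring

theorem regular_variation_asympVar (f K L : ℝ → ℝ) (θ α ℓ : ℝ)
    (hf : IsPDF f) (hfs : SymmAbout f θ) (hfu : UnimodalAbout f θ)
    (hα : α < -3)
    (hrep : ∀ x : ℝ, 0 < x → f (θ + x) = x ^ α * L x)
    (hLbdd : ∃ C, ∀ x, |L x| ≤ C)
    (hLslow : ∀ lam : ℝ, 0 < lam →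
      Tendsto (fun x : ℝ => L (lam * x) / L x) atTop (𝓝 1))
    (hLlim : Tendsto L atTop (𝓝 ℓ)) (hℓ : 0 < ℓ)
    (hvar : MeasureTheory.Integrable (fun x : ℝ => (x - θ) ^ 2 * f x))
    (hK : BellShaped K) (hK''0 : deriv (deriv K) 0 < 0)
    (hI1 : IntegrableOn
      (fun x : ℝ => x ^ α * ((|deriv (deriv K) 0|⁻¹) ^ 2 * (deriv K x) ^ 2 - x ^ 2))
      (Set.Ioi 0))
    (hI1neg :
      (∫ x in Set.Ioi (0 : ℝ),
        x ^ α * ((|deriv (deriv K) 0|⁻¹) ^ 2 * (deriv K x) ^ 2 - x ^ 2)) < 0)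
    (hI2 : IntegrableOn
      (fun x : ℝ => x ^ α * (1 + |deriv (deriv K) 0|⁻¹ * deriv (deriv K) x))
      (Set.Ioi 0)) :
    Tendsto
      (fun h : ℝ =>
        h ^ (-(α + 3)) * (asympVar K f θ h - ∫ x, (x - θ) ^ 2 * f x)) atTop
      (𝓝 (2 * ℓ *
        ∫ x in Set.Ioi (0 : ℝ),
          x ^ α * ((|deriv (deriv K) 0|⁻¹) ^ 2 * (deriv K x) ^ 2 - x ^ 2))) ∧
    ∀ᶠ h in atTop, asympVar K f θ h < ∫ x, (x - θ) ^ 2 * f x := by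
  obtain ⟨hf0, hfi, hf1⟩ := hf
  obtain ⟨-, hKc, hKs, -, ⟨C1, hC1⟩, ⟨C2, hC2⟩, -⟩ := hK
  have hc1 : Continuous (deriv K) := hKc.continuous_deriv (by norm_num)
  have hc2 : Continuous (deriv (deriv K)) := by
    have h2 : ContDiff ℝ (1 + 1) K := by simpa [one_add_one_eq_two] using hKc
    have := (contDiff_succ_iff_deriv.1 h2).2.2
    exact this.continuous_deriv (by norm_num)
  have hKe : (fun x => K (-x)) = K := by
    ext x
    have := hKs x
    simpa using this.symm
  have ho : ∀ x, deriv K (-x) = - deriv K x := by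
    intro x
    have := deriv_comp_neg K x
    rw [hKe] at this
    linarith
  have he : ∀ x, deriv (deriv K) (-x) = deriv (deriv K) x := by
    intro x
    have h1 := deriv_comp_neg (deriv K) x
    have h2 : (fun x => deriv K (-x)) = fun x => - deriv K x := funext ho
    rw [h2, deriv.fun_neg] at h1
    linarith
  have hcpos : 0 < |deriv (deriv K) 0|⁻¹ := inv_pos.2 (abs_pos.2 hK''0.ne)
  generalize |deriv (deriv K) 0|⁻¹ = c at *
  have T1 := aux_lim_s7 f L (fun x => c ^ 2 * (deriv K x) ^ 2 - x ^ 2) θ α ℓ hfi hfs hrep hLbdd hLlim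
    (by fun_prop) (by intro x; simp [ho]) hI1
  have T2 := aux_lim_s7 f L (fun x => 1 + c * deriv (deriv K) x) θ α ℓ hfi hfs hrep hLbdd hLlim
    (by fun_prop) (by intro x; simp [he]) hI2
  generalize (∫ x in Set.Ioi (0 : ℝ), x ^ α * (c ^ 2 * (deriv K x) ^ 2 - x ^ 2)) = I at *
  generalize 2 * ℓ * (∫ x in Set.Ioi (0 : ℝ), x ^ α * (1 + c * deriv (deriv K) x)) = J at *
  have hA : ∀ h : ℝ, Integrable (fun x => (deriv K ((θ - x) / h)) ^ 2 * f x) := by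
    intro h
    refine hfi.bdd_mul (c := C1 ^ 2) (by fun_prop) (ae_of_all _ fun x => ?_)
    rw [norm_pow]
    exact pow_le_pow_left₀ (norm_nonneg _) (hC1 _) 2
  have hB : ∀ h : ℝ, Integrable (fun x => deriv (deriv K) ((θ - x) / h) * f x) := by
    intro h
    exact hfi.bdd_mul (c := C2) (by fun_prop) (ae_of_all _ fun x => hC2 _)
  set σ := ∫ x, (x - θ) ^ 2 * f x with hσ
  have eP : ∀ h : ℝ, (∫ x, (c ^ 2 * (deriv K ((θ - x) / h)) ^ 2 - ((θ - x) / h) ^ 2) * f x)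
      = c ^ 2 * (∫ x, (deriv K ((θ - x) / h)) ^ 2 * f x) - σ / h ^ 2 := by
    intro h
    rw [hσ, ← integral_const_mul, ← integral_div, ← integral_sub ((hA h).const_mul _)
      (hvar.div_const _)]
    congr 1
    ext x
    rw [div_pow]
    ring
  have eQ : ∀ h : ℝ, (∫ x, (1 + c * deriv (deriv K) ((θ - x) / h)) * f x)
      = 1 + c * (∫ x, deriv (deriv K) ((θ - x) / h) * f x) := by
    intro h
    have := integral_add hfi ((hB h).const_mul c)
    rw [hf1, integral_const_mul] at this
    rw [← this]
    congr 1
    ext x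
    ring
  have eV : ∀ h : ℝ, 0 < h → asympVar K f θ h =
      h ^ 2 * (∫ x, (deriv K ((θ - x) / h)) ^ 2 * f x) /
        (∫ x, deriv (deriv K) ((θ - x) / h) * f x) ^ 2 := by
    intro h hh
    have n1 : (∫ x, (deriv (Kh K h) (θ - x)) ^ 2 * f x)
        = (∫ x, (deriv K ((θ - x) / h)) ^ 2 * f x) / h ^ 4 := by
      rw [← integral_div]
      congr 1
      ext x
      rw [aux_dKh, div_pow]
      ring
    have n2 : (∫ x, deriv (deriv (Kh K h)) (θ - x) * f x)
        = (∫ x, deriv (deriv K) ((θ - x) / h) * f x) / h ^ 3 := by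
      rw [← integral_div]
      congr 1
      ext x
      rw [aux_ddKh]
      ring
    rw [asympVar, n1, n2, div_pow, div_div_eq_mul_div]
    congr 1
    field_simp
  simp only [eP] at T1
  simp only [eQ] at T2
  generalize hAd : (fun h : ℝ => ∫ x, (deriv K ((θ - x) / h)) ^ 2 * f x) = A at *
  generalize hBd : (fun h : ℝ => ∫ x, deriv (deriv K) ((θ - x) / h) * f x) = B at *
  have hAh : ∀ h, (∫ x, (deriv K ((θ - x) / h)) ^ 2 * f x) = A h := fun h => congrFun hAd h
  have hBh : ∀ h, (∫ x, deriv (deriv K) ((θ - x) / h) * f x) = B h := fun h => congrFun hBd h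
  simp only [hAh] at T1 eV
  simp only [hBh] at T2 eV
  have hz : Tendsto (fun h : ℝ => h ^ (α + 1)) atTop (𝓝 0) := by
    have := tendsto_rpow_neg_atTop (y := -(α + 1)) (by linarith)
    simpa only [neg_neg] using this
  have hQ0 : Tendsto (fun h => 1 + c * B h) atTop (𝓝 0) := by
    have := hz.mul T2
    rw [zero_mul] at this
    refine this.congr' ?_
    filter_upwards [eventually_gt_atTop 0] with h hh
    rw [← mul_assoc, ← Real.rpow_add hh]
    simp
  have hz2 : Tendsto (fun h : ℝ => (h ^ 2)⁻¹) atTop (𝓝 0) :=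
    (tendsto_pow_atTop two_ne_zero).inv_tendsto_atTop
  have hcB : Tendsto (fun h => (c * B h) ^ 2) atTop (𝓝 1) := by
    have := (hQ0.sub_const 1).pow 2
    simpa using this
  have main : Tendsto (fun h : ℝ =>
      (h ^ (-(α + 1)) * (c ^ 2 * A h - σ / h ^ 2)) / (c * B h) ^ 2 +
      σ * ((h ^ 2)⁻¹ * (h ^ (-(α + 1)) * (1 + c * B h))) * (2 - (1 + c * B h)) / (c * B h) ^ 2)
      atTop (𝓝 ((2 * ℓ * I) / 1 + σ * (0 * J) * (2 - 0) / 1)) :=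
    (T1.div hcB one_ne_zero).add
      ((((hz2.mul T2).const_mul σ).mul (hQ0.const_sub 2)).div hcB one_ne_zero)
  have lim : Tendsto (fun h : ℝ => h ^ (-(α + 3)) * (asympVar K f θ h - σ)) atTop
      (𝓝 (2 * ℓ * I)) := by
    have e : (2 * ℓ * I) / 1 + σ * (0 * J) * (2 - 0) / 1 = 2 * ℓ * I := by ring
    rw [e] at main
    refine main.congr' ?_
    filter_upwards [eventually_gt_atTop 0, hcB.eventually_ne one_ne_zero] with h hh hne
    have hB0 : B h ≠ 0 := by
      intro h0
      apply hne
      simp [h0]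
    have e1 : h ^ (-(α + 1)) = h ^ (-(α + 3)) * h ^ 2 := by
      rw [← Real.rpow_natCast h 2, ← Real.rpow_add hh]
      congr 1
      push_cast
      ring
    rw [eV h hh, e1]
    field_simp
    ring
  refine ⟨lim, ?_⟩
  have hneg : 2 * ℓ * I < 0 := mul_neg_of_pos_of_neg (by linarith) hI1neg
  filter_upwards [lim.eventually_lt_const hneg, eventually_gt_atTop 0] with h h1 hh
  have := Real.rpow_pos_of_pos hh (-(α + 3))
  by_contra hcon
  have : 0 ≤ h ^ (-(α + 3)) * (asympVar K f θ h - σ) :=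
    mul_nonneg this.le (sub_nonneg.2 (not_lt.1 hcon))
  linarith
end
end

section
/- Assume f is a pdf symmetric and unimodal about θ with finite variance σ², twice continuously differentiable with bounded f′, integrable f″, and f″(θ) < 0; assume f₀(x) = f(θ+x) = x^α L(x) is regularly varying with index α < −3, L bounded slowly varying with L(h) → ℓ > 0. Assume K is a bell-shaped kernel with K″(0) < 0, lim_{x→∞} x K(x) = 0, ∫ K′(x)² dx < ∞, I_{K,α} = ∫₀^∞ x^α [|K″(0)|⁻² K′(x)² − x²] dx finite and negative, and ∫₀^∞ x^α [1 + |K″(0)|⁻¹ K″(x)] dx finite. Define V(h) = σ²_{K,h} = ∫ K_h′(θ−x)² f(x) dx / (∫ K_h″(θ−x) f(x) dx)² for h ∈ (0,∞); V is continuous. Then there exists h* ∈ (0,∞) such that V(h*) = inf_{h ∈ (0,∞)} V(h) < σ². -/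
open MeasureTheory Real Filter Topology Set

noncomputable section

lemma scaleInt (f g : ℝ → ℝ) (θ h : ℝ) (hh : 0 < h) (hfs : SymmAbout f θ)
    (hg : ∀ u, g (-u) = g u) :
    ∫ x, g ((θ - x) / h) * f x = 2 * h * ∫ u in Ioi (0:ℝ), g u * f (θ + h * u) := by
  have e1 : ∫ x, g ((θ - x) / h) * f x = ∫ y, g (y / h) * f (θ - y) := by
    rw [← integral_sub_left_eq_self (fun y => g (y / h) * f (θ - y)) volume θ]
    simp
  have e2 := Measure.integral_comp_mul_left (fun y => g (y / h) * f (θ - y)) h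
  have e3 : ∫ u, g (h * u / h) * f (θ - h * u) = 2 * ∫ u in Ioi (0:ℝ), g u * f (θ + h * u) := by
    rw [← integral_comp_abs (f := fun u => g u * f (θ + h * u))]
    congr 1; ext u
    rw [mul_div_cancel_left₀ _ hh.ne']
    rcases abs_choice u with h1 | h1 <;> rw [h1]
    · rw [hfs]
    · rw [hg]; congr 2; ring
  rw [e1]
  simp only [abs_of_pos (inv_pos.2 hh), smul_eq_mul] at e2
  rw [e3] at e2
  field_simp at e2
  linarith

lemma deriv_Kh (K : ℝ → ℝ) (h : ℝ) (hK : Differentiable ℝ K) :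
    deriv (Kh K h) = fun x => deriv K (x / h) / h ^ 2 := by
  ext x
  have := ((hK (x/h)).hasDerivAt.comp x ((hasDerivAt_id x).div_const h)).div_const h
  have h2 : HasDerivAt (Kh K h) (deriv K (x / h) * (1 / h) / h) x := this
  rw [h2.deriv]; ring

lemma deriv2_Kh (K : ℝ → ℝ) (h : ℝ) (hK : Differentiable ℝ K) (hK' : Differentiable ℝ (deriv K)) :
    deriv (deriv (Kh K h)) = fun x => deriv (deriv K) (x / h) / h ^ 3 := by
  rw [deriv_Kh K h hK]
  ext x
  have := ((hK' (x/h)).hasDerivAt.comp x ((hasDerivAt_id x).div_const h)).div_const (h^2)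
  have h2 : HasDerivAt (fun x => deriv K (x / h) / h ^ 2) (deriv (deriv K) (x / h) * (1 / h) / h ^ 2) x := this
  rw [h2.deriv]; ring

lemma asympVar_eq (f K : ℝ → ℝ) (θ h : ℝ) (hh : 0 < h) (hfs : SymmAbout f θ)
    (hK : Differentiable ℝ K) (hK' : Differentiable ℝ (deriv K))
    (o1 : ∀ u, deriv K (-u) = - deriv K u) (o2 : ∀ u, deriv (deriv K) (-u) = deriv (deriv K) u) :
    asympVar K f θ h = h * (∫ u in Ioi (0:ℝ), (deriv K u)^2 * f (θ + h * u)) /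
      (2 * (∫ u in Ioi (0:ℝ), deriv (deriv K) u * f (θ + h * u)) ^ 2) := by
  unfold asympVar
  rw [deriv2_Kh K h hK hK', deriv_Kh K h hK]
  have e1 := scaleInt f (fun u => (deriv K u)^2) θ h hh hfs (by intro u; simp [o1])
  have e2 := scaleInt f (fun u => deriv (deriv K) u) θ h hh hfs o2
  have e3 : ∫ x, (deriv K ((θ - x) / h) / h ^ 2) ^ 2 * f x
      = (1 / h^4) * ∫ x, (deriv K ((θ - x) / h)) ^ 2 * f x := by
    rw [← integral_const_mul]; congr 1; ext x; ring
  have e4 : ∫ x, (deriv (deriv K) ((θ - x) / h) / h ^ 3) * f x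
      = (1 / h^3) * ∫ x, (deriv (deriv K) ((θ - x) / h)) * f x := by
    rw [← integral_const_mul]; congr 1; ext x; ring
  rw [e3, e4, e1, e2]
  set P := ∫ u in Ioi (0:ℝ), (deriv K u)^2 * f (θ + h * u)
  set Q := ∫ u in Ioi (0:ℝ), deriv (deriv K) u * f (θ + h * u)
  by_cases hQ : Q = 0
  · simp [hQ]
  · field_simp; try ring

lemma tailLim (f g L : ℝ → ℝ) (θ α ℓ : ℝ) (hfc : Continuous f) (hgc : Continuous g)
    (hrep : ∀ x : ℝ, 0 < x → f (θ + x) = x ^ α * L x)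
    (hLbdd : ∃ C, ∀ x, |L x| ≤ C)
    (hLlim : Tendsto L atTop (𝓝 ℓ))
    (hg : IntegrableOn (fun x => x ^ α * g x) (Ioi 0)) :
    Tendsto (fun h : ℝ => h ^ (-α) * ∫ u in Ioi (0:ℝ), g u * f (θ + h * u)) atTop
      (𝓝 (ℓ * ∫ x in Ioi (0:ℝ), x ^ α * g x)) := by
  obtain ⟨C, hC⟩ := hLbdd
  simp_rw [← integral_const_mul]
  have key : ∀ h : ℝ, 0 < h → ∀ u : ℝ, 0 < u →
      h ^ (-α) * (g u * f (θ + h * u)) = L (h * u) * (u ^ α * g u) := by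
    intro h hh u hu
    rw [hrep _ (mul_pos hh hu), mul_rpow hh.le hu.le, rpow_neg hh.le]
    have : h ^ α ≠ 0 := (rpow_pos_of_pos hh _).ne'
    field_simp
  apply tendsto_integral_filter_of_dominated_convergence (fun u => C * |u ^ α * g u|)
  · filter_upwards with h
    exact (by fun_prop : Continuous fun u => h ^ (-α) * (g u * f (θ + h * u))).aestronglyMeasurable
  · filter_upwards [eventually_gt_atTop 0] with h hh
    filter_upwards [ae_restrict_mem measurableSet_Ioi] with u hu
    rw [key h hh u hu, norm_mul]
    exact mul_le_mul_of_nonneg_right (hC _) (norm_nonneg _)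
  · exact (hg.abs).const_mul C
  · filter_upwards [ae_restrict_mem measurableSet_Ioi] with u hu
    have : Tendsto (fun h : ℝ => L (h * u) * (u ^ α * g u)) atTop (𝓝 (ℓ * (u ^ α * g u))) :=
      (hLlim.comp (tendsto_id.atTop_mul_const hu)).mul_const _
    refine this.congr' ?_
    filter_upwards [eventually_gt_atTop 0] with h hh
    exact (key h hh u hu).symm

lemma Pbound (f K : ℝ → ℝ) (θ : ℝ) (hfc : Continuous f) 
    (hf0 : ∀ x, 0 < f x) (hfle : ∀ x y, |x| ≤ |y| → f (θ + y) ≤ f (θ + x))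
    (hK' : Differentiable ℝ (deriv K)) (hK0 : deriv K 0 = 0)
    (hK''0 : deriv (deriv K) 0 < 0)
    (hRK' : Integrable (fun x : ℝ => (deriv K x) ^ 2)) :
    ∃ m > 0, ∀ h : ℝ, 0 < h → h ≤ 1 → m ≤ ∫ u in Ioi (0:ℝ), (deriv K u)^2 * f (θ + h * u) := by
  have hc : Continuous (deriv K) := hK'.continuous
  have hm : 0 < ∫ x in (0:ℝ)..1, (deriv K x)^2 := by
    apply intervalIntegral.integral_pos one_pos (by fun_prop) (fun x _ => sq_nonneg _)
    by_contra! hcon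
    have hz : ∀ x ∈ Icc (0:ℝ) 1, deriv K x = 0 := fun x hx => by
      have := hcon x hx
      nlinarith [sq_nonneg (deriv K x)]
    have h1 : HasDerivWithinAt (deriv K) (deriv (deriv K) 0) (Icc 0 1) 0 :=
      (hK' 0).hasDerivAt.hasDerivWithinAt
    have h2 : HasDerivWithinAt (deriv K) 0 (Icc 0 1) 0 :=
      (hasDerivWithinAt_const (0:ℝ) (Icc (0:ℝ) 1) (0:ℝ)).congr hz hK0
    have := (uniqueDiffOn_Icc (one_pos : (0:ℝ) < 1) 0 (by simp)).eq_deriv _ h1 h2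
    linarith
  refine ⟨f (θ + 1) * ∫ x in (0:ℝ)..1, (deriv K x)^2, mul_pos (hf0 _) hm, fun h hh h1 => ?_⟩
  have hint : Integrable (fun u => (deriv K u)^2 * f (θ + h * u)) := by
    refine hRK'.mul_bdd (c := f θ) (by fun_prop : Continuous _).aestronglyMeasurable ?_
    filter_upwards with u
    rw [norm_of_nonneg (hf0 _).le]
    simpa using hfle 0 (h * u) (by rw [abs_zero]; exact abs_nonneg _)
  rw [intervalIntegral.integral_of_le zero_le_one, ← integral_const_mul]
  calc _ ≤ ∫ u in Ioc (0:ℝ) 1, (deriv K u)^2 * f (θ + h * u) := by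
        apply setIntegral_mono_on (hRK'.integrableOn.const_mul _) hint.integrableOn measurableSet_Ioc
        intro u hu
        rw [mul_comm]
        apply mul_le_mul_of_nonneg_left _ (sq_nonneg _)
        apply hfle
        rw [abs_of_nonneg (mul_nonneg hh.le hu.1.le), abs_one]
        nlinarith [hu.1, hu.2]
    _ ≤ _ := by
        apply setIntegral_mono_set hint.integrableOn
        · filter_upwards with u
          exact mul_nonneg (sq_nonneg _) (hf0 _).le
        · exact Ioc_subset_Ioi_self.eventuallyLE

lemma intK' (K : ℝ → ℝ) (hK : Differentiable ℝ K) (hKn : ∀ x, 0 ≤ K x)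
    (hKu : UnimodalAbout K 0) (o1 : ∀ u, deriv K (-u) = - deriv K u)
    (hKtail : Tendsto (fun x : ℝ => x * K x) atTop (𝓝 0)) : Integrable (deriv K) := by
  have hanti : AntitoneOn K (Ioi 0) := by
    intro x hx y hy hxy
    rcases hxy.eq_or_lt with h | h
    · rw [h]
    by_cases h0 : K y = 0
    · rw [h0]; exact hKn x
    · have := hKu x y (by rwa [abs_of_pos hx, abs_of_pos hy]) (by simpa using h0)
      simpa using this.le
  have hneg : ∀ x ∈ Ioi (0:ℝ), deriv K x ≤ 0 := fun x hx => by
    rw [← derivWithin_of_isOpen isOpen_Ioi hx]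
    exact hanti.derivWithin_nonpos
  have hlim : Tendsto K atTop (𝓝 0) := by
    have := hKtail.mul tendsto_inv_atTop_zero
    simp only [mul_zero] at this
    refine this.congr' ?_
    filter_upwards [eventually_gt_atTop 0] with x hx
    field_simp
  have hI : IntegrableOn (deriv K) (Ioi 0) :=
    integrableOn_Ioi_deriv_of_nonpos' (fun x _ => (hK x).hasDerivAt) hneg hlim
  have hF : Integrable (indicator (Ioi 0) (deriv K)) := hI.integrable_indicator measurableSet_Ioi
  have hd := hF.sub hF.comp_neg
  refine hd.congr (ae_of_all _ fun x => ?_)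
  have h00 : deriv K 0 = 0 := by have := o1 0; simp at this; linarith
  simp only [Pi.sub_apply, indicator, mem_Ioi]
  rcases lt_trichotomy x 0 with h | h | h
  · simp [h, h.le, not_lt.2 h.le, o1]
  · simp [h, h00]
  · simp [h, not_lt.2 h.le]

lemma Qbound (f K : ℝ → ℝ) (θ : ℝ) (hf : Differentiable ℝ f) (hfi : Integrable f)
    (hf' : Continuous (deriv f))
    (hfs : SymmAbout f θ)
    (hfb : ∃ C, ∀ x, |deriv f x| ≤ C)
    (hK' : Differentiable ℝ (deriv K)) (hK'' : Continuous (deriv (deriv K)))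
    (b1 : ∃ C, ∀ x, |deriv K x| ≤ C) (b2 : ∃ C, ∀ x, |deriv (deriv K) x| ≤ C) 
    (hi : Integrable (deriv K)) 
    (o2 : ∀ u, deriv (deriv K) (-u) = deriv (deriv K) u) :
    ∃ C > 0, ∀ h : ℝ, 0 < h → |∫ u in Ioi (0:ℝ), deriv (deriv K) u * f (θ + h * u)| ≤ C * h := by
  obtain ⟨A, hA⟩ := hfb
  obtain ⟨B1, hB1⟩ := b1
  obtain ⟨B2, hB2⟩ := b2
  have hA0 : 0 ≤ A := (abs_nonneg _).trans (hA 0)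
  have hi0 : 0 ≤ ∫ u, |deriv K u| := integral_nonneg fun _ => abs_nonneg _
  refine ⟨A * (∫ u, |deriv K u|) + 1, by positivity, fun h hh => ?_⟩
  have hfc := hf.continuous
  have hKc := hK'.continuous
  have e1 := scaleInt (fun y => f (θ + h * y)) (deriv (deriv K)) 0 1 one_pos
    (by intro x; simpa [sub_eq_add_neg] using hfs (h * x)) o2
  simp only [zero_sub, div_one, o2, zero_add, one_mul, mul_one] at e1
  have hfh : Integrable (fun u => f (θ + h * u)) := by
    have := (hfi.comp_add_left θ).comp_mul_left' hh.ne'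
    simpa using this
  have hd : ∀ x, HasDerivAt (fun u => f (θ + h * u)) (h * deriv f (θ + h * x)) x := fun x => by
    have h1 : HasDerivAt (fun u => θ + h * u) h x := by
      simpa using ((hasDerivAt_id x).const_mul h).const_add θ
    have := (hf (θ + h * x)).hasDerivAt.comp x h1
    rw [mul_comm]; exact this
  have e2 := integral_mul_deriv_eq_deriv_mul_of_integrable (u := deriv K) (u' := deriv (deriv K))
    (v := fun u => f (θ + h * u)) (v' := fun u => h * deriv f (θ + h * u))
    (fun x _ => (hK' x).hasDerivAt) (fun x _ => hd x)
    (hi.mul_bdd (c := h * A) (by fun_prop : Continuous _).aestronglyMeasurable (by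
      filter_upwards with u
      rw [norm_mul, norm_of_nonneg hh.le]
      exact mul_le_mul_of_nonneg_left (hA _) hh.le))
    (hfh.bdd_mul (c := B2) hK''.aestronglyMeasurable (ae_of_all _ hB2))
    (hfh.bdd_mul (c := B1) hKc.aestronglyMeasurable (ae_of_all _ hB1))
  have e3 : |∫ u, deriv K u * (h * deriv f (θ + h * u))| ≤ h * A * ∫ u, |deriv K u| := by
    rw [← integral_const_mul, ← norm_eq_abs]
    refine norm_integral_le_of_norm_le (hi.abs.const_mul _) (ae_of_all _ fun u => ?_)
    rw [norm_mul, norm_mul, norm_of_nonneg hh.le, mul_comm]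
    exact mul_le_mul_of_nonneg_right (mul_le_mul_of_nonneg_left (hA _) hh.le) (abs_nonneg _)
  rw [e2, e1, abs_neg, abs_mul, abs_two] at e3
  have := abs_nonneg (∫ u in Ioi (0:ℝ), deriv (deriv K) u * f (θ + h * u))
  nlinarith

lemma existsMin (V : ℝ → ℝ) (s : ℝ) (hV : ContinuousOn V (Ioi 0)) (h0 : ∀ h, 0 < h → 0 ≤ V h)
    (c : ℝ) (hc : 0 < c) (hsm : ∀ h, 0 < h → h ≤ 1 → V h ≠ 0 → c / h ≤ V h)
    (hlim : Tendsto V atTop (𝓝 s)) (h1 : ℝ) (h1p : 0 < h1) (hlt : V h1 < s) :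
    ∃ hs, 0 < hs ∧ (∀ h, 0 < h → V hs ≤ V h) ∧ V hs < s := by
  by_cases hz : ∃ h, 0 < h ∧ V h = 0
  · obtain ⟨h, hp, hv⟩ := hz
    exact ⟨h, hp, fun k hk => hv ▸ h0 k hk, by rw [hv]; exact (h0 h1 h1p).trans_lt hlt⟩
  push Not at hz
  obtain ⟨H, hH⟩ := eventually_atTop.1 (hlim.eventually (lt_mem_nhds hlt))
  set v := V h1 with hv
  have hvp : 0 < v := lt_of_le_of_ne (h0 h1 h1p) (hz h1 h1p).symm
  set d := min (min 1 (c / v)) h1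
  have hd : 0 < d := by positivity
  set M := max H h1
  have hsub : Icc d M ⊆ Ioi 0 := fun x hx => hd.trans_le hx.1
  have hmem : h1 ∈ Icc d M := ⟨min_le_right _ _, le_max_right _ _⟩
  obtain ⟨x, hx, hmin⟩ := isCompact_Icc.exists_isMinOn ⟨h1, hmem⟩ (hV.mono hsub)
  have hx1 : V x ≤ v := hmin hmem
  refine ⟨x, hsub hx, fun h hh => ?_, hx1.trans_lt hlt⟩
  rcases lt_or_ge h d with hd1 | hd1
  · have a1 : h ≤ 1 := hd1.le.trans ((min_le_left _ _).trans (min_le_left _ _))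
    have a2 : h ≤ c / v := hd1.le.trans ((min_le_left _ _).trans (min_le_right _ _))
    have a3 := hsm h hh a1 (hz h hh)
    have : v ≤ c / h := by
      rw [le_div_iff₀ hh]; rw [le_div_iff₀ hvp] at a2; linarith
    linarith
  · rcases le_or_gt h M with hM | hM
    · exact hmin ⟨hd1, hM⟩
    · exact hx1.trans (hH h ((le_max_left _ _).trans hM.le)).le
theorem exists_optimal_bandwidth (f K L : ℝ → ℝ) (θ α ℓ : ℝ)
    (hf : IsPDF f) (hfs : SymmAbout f θ) (hfu : UnimodalAbout f θ)
    (hf2 : ContDiff ℝ 2 f)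
    (hf'bdd : ∃ C, ∀ x, |deriv f x| ≤ C)
    (hf''int : MeasureTheory.Integrable (deriv (deriv f)))
    (hf''θ : deriv (deriv f) θ < 0)
    (hvar : MeasureTheory.Integrable (fun x : ℝ => (x - θ) ^ 2 * f x))
    (hα : α < -3)
    (hrep : ∀ x : ℝ, 0 < x → f (θ + x) = x ^ α * L x)
    (hLbdd : ∃ C, ∀ x, |L x| ≤ C)
    (hLslow : ∀ lam : ℝ, 0 < lam →
      Tendsto (fun x : ℝ => L (lam * x) / L x) atTop (𝓝 1))
    (hLlim : Tendsto L atTop (𝓝 ℓ)) (hℓ : 0 < ℓ)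
    (hK : BellShaped K) (hK''0 : deriv (deriv K) 0 < 0)
    (hKtail : Tendsto (fun x : ℝ => x * K x) atTop (𝓝 0))
    (hRK' : MeasureTheory.Integrable (fun x : ℝ => (deriv K x) ^ 2))
    (hI1 : IntegrableOn
      (fun x : ℝ => x ^ α * ((|deriv (deriv K) 0|⁻¹) ^ 2 * (deriv K x) ^ 2 - x ^ 2))
      (Set.Ioi 0))
    (hI1neg :
      (∫ x in Set.Ioi (0 : ℝ),
        x ^ α * ((|deriv (deriv K) 0|⁻¹) ^ 2 * (deriv K x) ^ 2 - x ^ 2)) < 0)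
    (hI2 : IntegrableOn
      (fun x : ℝ => x ^ α * (1 + |deriv (deriv K) 0|⁻¹ * deriv (deriv K) x))
      (Set.Ioi 0))
    (hVcont : ContinuousOn (fun h : ℝ => asympVar K f θ h) (Set.Ioi 0)) :
    ∃ hstar : ℝ, 0 < hstar ∧
      (∀ h : ℝ, 0 < h → asympVar K f θ hstar ≤ asympVar K f θ h) ∧
      asympVar K f θ hstar < ∫ x, (x - θ) ^ 2 * f x := by
  obtain ⟨hKpdf, hK2, hKs, hKu, hKb1, hKb2, -⟩ := hK
  have hKd : Differentiable ℝ K := hK2.differentiable (by norm_num)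
  have hK1 : ContDiff ℝ 1 (deriv K) := (contDiff_succ_iff_deriv (n := 1)).1 hK2 |>.2.2
  have hKd' : Differentiable ℝ (deriv K) := hK1.differentiable (by norm_num)
  have hKc'' : Continuous (deriv (deriv K)) := hK1.continuous_deriv (by norm_num)
  have hKc' : Continuous (deriv K) := hKd'.continuous
  have hfd : Differentiable ℝ f := hf2.differentiable (by norm_num)
  have hfc' : Continuous (deriv f) := hf2.continuous_deriv (by norm_num)
  have hfc := hfd.continuous
  have o1 : ∀ u, deriv K (-u) = - deriv K u := by
    intro u
    have h1 : (fun x => K (-x)) = K := by ext x; simpa using (hKs x).symm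
    have := deriv_comp_neg K u
    rw [h1] at this; linarith
  have o2 : ∀ u, deriv (deriv K) (-u) = deriv (deriv K) u := by
    intro u
    have h1 : (fun x => deriv K (-x)) = fun x => - deriv K x := by ext x; exact o1 x
    have := deriv_comp_neg (deriv K) u
    rw [h1, deriv.fun_neg] at this; linarith
  have hK0 : deriv K 0 = 0 := by have := o1 0; simp at this; linarith
  -- positivity of f
  have hfpos : ∀ x, 0 < f (θ + x) := by
    intro x
    obtain ⟨y, hy1, hy2⟩ := ((eventually_gt_atTop |x|).and
      (hLlim.eventually (lt_mem_nhds hℓ))).exists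
    have hy0 : 0 < y := (abs_nonneg x).trans_lt hy1
    have hp : 0 < f (θ + y) := by
      rw [hrep y hy0]; exact mul_pos (rpow_pos_of_pos hy0 _) hy2
    exact hp.trans (hfu x y (by rwa [abs_of_pos hy0]) hp.ne')
  have hfpos' : ∀ x, 0 < f x := fun x => by simpa using hfpos (x - θ)
  have hfle : ∀ x y, |x| ≤ |y| → f (θ + y) ≤ f (θ + x) := by
    intro x y hxy
    rcases hxy.eq_or_lt with h | h
    · rcases abs_eq_abs.1 h with h | h
      · rw [h]
      · rw [h, ← sub_eq_add_neg, hfs]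
    · exact (hfu x y h (hfpos y).ne').le
  set P : ℝ → ℝ := fun h => ∫ u in Ioi (0:ℝ), (deriv K u)^2 * f (θ + h * u) with hPdef
  set Q : ℝ → ℝ := fun h => ∫ u in Ioi (0:ℝ), deriv (deriv K) u * f (θ + h * u) with hQdef
  have hV : ∀ h, 0 < h → asympVar K f θ h = h * P h / (2 * Q h ^ 2) := fun h hh =>
    asympVar_eq f K θ h hh hfs hKd hKd' o1 o2
  obtain ⟨m, hm, hP⟩ := Pbound f K θ hfc hfpos' hfle hKd' hK0 hK''0 hRK'
  obtain ⟨C, hC, hQ⟩ := Qbound f K θ hfd hf.2.1 hfc' hfs hf'bdd hKd' hKc'' hKb1 hKb2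
    (intK' K hKd hKpdf.1 hKu o1 hKtail) o2
  have hPn : ∀ h, 0 ≤ P h := fun h => integral_nonneg fun u => mul_nonneg (sq_nonneg _) (hfpos' _).le
  set c := |deriv (deriv K) 0| with hcdef
  have hc : 0 < c := abs_pos.2 hK''0.ne
  set s := ∫ x, (x - θ) ^ 2 * f x with hs
  -- tail limits
  have t1 := tailLim f (fun x => (c⁻¹) ^ 2 * (deriv K x) ^ 2 - x ^ 2) L θ α ℓ hfc (by fun_prop)
    hrep hLbdd hLlim hI1
  have t2 := tailLim f (fun x => 1 + c⁻¹ * deriv (deriv K) x) L θ α ℓ hfc (by fun_prop)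
    hrep hLbdd hLlim hI2
  set I1 := ∫ x in Ioi (0:ℝ), x ^ α * ((c⁻¹) ^ 2 * (deriv K x) ^ 2 - x ^ 2)
  set I2 := ∫ x in Ioi (0:ℝ), x ^ α * (1 + c⁻¹ * deriv (deriv K) x)
  set a : ℝ → ℝ := fun h => h ^ (-α) * ∫ u in Ioi (0:ℝ), ((c⁻¹) ^ 2 * (deriv K u) ^ 2 - u ^ 2) * f (θ + h * u) with ha
  set b : ℝ → ℝ := fun h => h ^ (-α) * ∫ u in Ioi (0:ℝ), (1 + c⁻¹ * deriv (deriv K) u) * f (θ + h * u) with hb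
  have hfh : ∀ h, 0 < h → Integrable (fun u => f (θ + h * u)) := fun h hh => by
    simpa using (hf.2.1.comp_add_left θ).comp_mul_left' hh.ne'
  have hvh : ∀ h, 0 < h → Integrable (fun u => u ^ 2 * f (θ + h * u)) := fun h hh => by
    have h1 := ((hvar.comp_add_left θ).comp_mul_left' hh.ne').const_mul (h ^ 2)⁻¹
    refine h1.congr (ae_of_all _ fun u => ?_)
    simp only [add_sub_cancel_left]
    field_simp
  have hS : ∀ h, 0 < h → s = 2 * h ^ 3 * ∫ u in Ioi (0:ℝ), u ^ 2 * f (θ + h * u) := fun h hh => by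
    have e := scaleInt f (fun u => u ^ 2) θ h hh hfs (by intro u; simp)
    have e' : s = h ^ 2 * ∫ x, ((θ - x) / h) ^ 2 * f x := by
      rw [hs, ← integral_const_mul]; congr 1; ext x; field_simp; ring
    rw [e', e]; ring
  have hT : ∀ h, 0 < h → 1 = 2 * h * ∫ u in Ioi (0:ℝ), f (θ + h * u) := fun h hh => by
    have e := scaleInt f (fun u => 1) θ h hh hfs (by intro u; simp)
    simp only [one_mul, hf.2.2] at e
    exact e
  have hpa : ∀ h, 0 < h → 2 * h ^ 3 * P h / c ^ 2 = s + 2 * h ^ (3 + α) * a h := by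
    intro h hh
    have hKi : Integrable (fun u => (deriv K u)^2 * f (θ + h * u)) := by
      refine hRK'.mul_bdd (c := f θ) (by fun_prop : Continuous _).aestronglyMeasurable ?_
      filter_upwards with u
      rw [norm_of_nonneg (hfpos' _).le]
      simpa using hfle 0 (h * u) (by rw [abs_zero]; exact abs_nonneg _)
    have e : a h = h ^ (-α) * ((c⁻¹) ^ 2 * P h - ∫ u in Ioi (0:ℝ), u ^ 2 * f (θ + h * u)) := by
      simp only [ha, hPdef]
      rw [← integral_const_mul (c⁻¹ ^ 2), ← integral_sub (hKi.integrableOn.const_mul _) (hvh h hh).integrableOn]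
      congr 2; ext u; ring
    rw [e, hS h hh, rpow_add hh, rpow_neg hh.le]
    have : h ^ α ≠ 0 := (rpow_pos_of_pos hh _).ne'
    norm_cast
    field_simp
    try ring
  have hqb : ∀ h, 0 < h → -(2 * h * Q h) / c = 1 - 2 * h ^ (1 + α) * b h := by
    intro h hh
    obtain ⟨B2, hB2⟩ := hKb2
    have hKi : Integrable (fun u => deriv (deriv K) u * f (θ + h * u)) :=
      (hfh h hh).bdd_mul (c := B2) hKc''.aestronglyMeasurable (ae_of_all _ hB2)
    have e : b h = h ^ (-α) * ((∫ u in Ioi (0:ℝ), f (θ + h * u)) + c⁻¹ * Q h) := by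
      simp only [hb, hQdef]
      rw [← integral_const_mul c⁻¹, ← integral_add (hfh h hh).integrableOn (hKi.integrableOn.const_mul _)]
      congr 2; ext u; ring
    have h2 := hT h hh
    have : h ^ α ≠ 0 := (rpow_pos_of_pos hh _).ne'
    have e3 : 2 * h ^ (1 + α) * b h = 1 + 2 * h * c⁻¹ * Q h := by
      rw [e, rpow_add hh, rpow_neg hh.le, rpow_one]
      field_simp
      field_simp at h2
      linear_combination -c * h2
    rw [e3]; field_simp; ring
  set p : ℝ → ℝ := fun h => s + 2 * h ^ (3 + α) * a h with hp
  set q : ℝ → ℝ := fun h => 1 - 2 * h ^ (1 + α) * b h with hq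
  have hVpq : ∀ h, 0 < h → asympVar K f θ h = p h / q h ^ 2 := by
    intro h hh
    rw [hV h hh, hp, hq]
    simp only
    rw [← hpa h hh, ← hqb h hh]
    by_cases h0 : Q h = 0
    · simp [h0]
    · field_simp; try ring
  have r3 : Tendsto (fun h : ℝ => h ^ (3 + α)) atTop (𝓝 0) := by
    have := tendsto_rpow_neg_atTop (y := -(3 + α)) (by linarith)
    simpa only [neg_neg] using this
  have r1 : Tendsto (fun h : ℝ => h ^ (1 + α)) atTop (𝓝 0) := by
    have := tendsto_rpow_neg_atTop (y := -(1 + α)) (by linarith)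
    simpa only [neg_neg] using this
  have lp : Tendsto p atTop (𝓝 s) := by
    simpa using ((r3.const_mul 2).mul t1).const_add s
  have lq : Tendsto q atTop (𝓝 1) := by
    simpa using ((r1.const_mul 2).mul t2).const_sub 1
  have lV : Tendsto (fun h => asympVar K f θ h) atTop (𝓝 s) := by
    have := lp.div (lq.pow 2) (by norm_num)
    simp only [one_pow, div_one] at this
    refine this.congr' ?_
    filter_upwards [eventually_gt_atTop 0] with h hh
    exact (hVpq h hh).symm
  -- a bandwidth beating σ²
  have hlt : ∃ h, 0 < h ∧ asympVar K f θ h < s := by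
    have l1 : Tendsto (fun h : ℝ => h ^ 2 * a h) atTop atBot :=
      (tendsto_pow_atTop two_ne_zero).atTop_mul_neg (mul_neg_of_pos_of_neg hℓ hI1neg) t1
    have l2 : Tendsto (fun h => -(2 * s * b h)) atTop (𝓝 (-(2 * s * (ℓ * I2)))) :=
      (t2.const_mul _).neg
    obtain ⟨h, hh, hq0, h1, h2⟩ := ((eventually_gt_atTop 0).and
      ((lq.eventually (lt_mem_nhds one_pos)).and
      ((l1.eventually (eventually_lt_atBot (-(2 * s * (ℓ * I2)) - 1))).and
        (l2.eventually (lt_mem_nhds (sub_one_lt _)))))).exists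
    refine ⟨h, hh, ?_⟩
    rw [hVpq h hh, div_lt_iff₀ (by positivity)]
    have hr : 0 < h ^ (1 + α) := rpow_pos_of_pos hh _
    have e3 : h ^ (3 + α) = h ^ (1 + α) * h ^ 2 := by
      rw [← rpow_natCast, ← rpow_add hh]; congr 1; push_cast; ring
    have hs0 : 0 ≤ s := integral_nonneg fun x => mul_nonneg (sq_nonneg _) (hfpos' _).le
    simp only [hp, hq]
    rw [e3]
    have k := mul_lt_mul_of_pos_left (h1.trans h2) hr
    nlinarith [mul_nonneg hs0 (sq_nonneg (2 * h ^ (1 + α) * b h))]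
  obtain ⟨h1, h1p, h1lt⟩ := hlt
  refine existsMin (fun h => asympVar K f θ h) s hVcont ?_ (m / (2 * C ^ 2)) (by positivity) ?_ lV h1 h1p h1lt
  · intro h hh
    rw [hV h hh]
    have := hPn h
    positivity
  · intro h hh hle hne
    rw [hV h hh] at hne ⊢
    have hQ0 : Q h ≠ 0 := by
      intro h0; apply hne; simp [h0]
    have hQ2 : 0 < Q h ^ 2 := by positivity
    have hQ3 : Q h ^ 2 ≤ (C * h) ^ 2 := by
      rw [← sq_abs]; exact pow_le_pow_left₀ (abs_nonneg _) (hQ h hh) 2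
    have hP1 := hP h hh hle
    calc m / (2 * C ^ 2) / h = h * m / (2 * (C * h) ^ 2) := by field_simp
      _ ≤ h * P h / (2 * Q h ^ 2) := by
        have := mul_nonneg hh.le (hPn h)
        gcongr
end
end

section
/- For β > 0 define the bump-like function φ_β(x) = exp(−1/(1 − |x|^β)) for |x| < 1 and φ_β(x) = 0 otherwise, and let K_β be the pdf kernel whose derivative satisfies K_β′(x) = −c_β · x · φ_β(x) for a suitable normalizing constant c_β > 0. Then K_β is a bell-shaped kernel with support [−1,1], and if α < −3 satisfies |α+1| < β, then: K_β″(0) < 0; I_{K_β,α} = ∫₀^∞ x^α [|K_β″(0)|⁻² K_β′(x)² − x²] dx is finite and negative; and ∫₀^∞ x^α [1 + |K_β″(0)|⁻¹ K_β″(x)] dx is finite. Hence K_β satisfies all the kernel hypotheses of the regular-variation theorem and of the optimal-bandwidth corollary. -/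
open MeasureTheory Real Filter Topology Set

noncomputable section

/-- The bump-like function `φ_β(x) = exp(-1/(1-|x|^β))` for `|x| < 1`, `0` otherwise. -/
def phiB (β x : ℝ) : ℝ :=
  if |x| < 1 then Real.exp (-(1 - |x| ^ β)⁻¹) else 0

def Ed (s : ℝ) : ℝ := s⁻¹ ^ 2 * expNegInvGlue s

lemma hasDerivAt_E (s : ℝ) : HasDerivAt expNegInvGlue (Ed s) s := by
  have := expNegInvGlue.hasDerivAt_polynomial_eval_inv_mul 1 s
  simpa [Ed] using this

lemma continuous_E : Continuous expNegInvGlue :=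
  continuous_iff_continuousAt.2 fun s => (hasDerivAt_E s).continuousAt

lemma continuous_Ed : Continuous Ed := by
  have := expNegInvGlue.continuous_polynomial_eval_inv_mul (Polynomial.X ^ 2)
  have e : Ed = fun x => (x ^ 2)⁻¹ * expNegInvGlue x := by
    funext x; simp [Ed]
  rw [e]
  simpa using this

lemma Ed_nonneg (s : ℝ) : 0 ≤ Ed s := mul_nonneg (sq_nonneg _) (expNegInvGlue.nonneg _)

lemma E_lip : ∃ M : ℝ, 0 ≤ M ∧ ∀ t : ℝ, 0 ≤ t → t ≤ 1 →
    Ed (1 - t) ≤ M ∧ |expNegInvGlue 1 - expNegInvGlue (1 - t)| ≤ M * t := by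
  obtain ⟨M, hM⟩ := (isCompact_Icc (a := (0:ℝ)) (b := 1)).exists_bound_of_continuousOn
    continuous_Ed.continuousOn
  refine ⟨M, (norm_nonneg _).trans (hM 0 (by simp)), fun t h0 h1 => ?_⟩
  have hm : (1 - t) ∈ Icc (0:ℝ) 1 := ⟨by linarith, by linarith⟩
  refine ⟨(le_abs_self _).trans (hM _ hm), ?_⟩
  have := (convex_Icc (0:ℝ) 1).norm_image_sub_le_of_norm_hasDerivWithin_le
    (fun x _ => (hasDerivAt_E x).hasDerivWithinAt) hM hm (y := 1) (by simp)
  simpa [Real.norm_eq_abs, abs_of_nonneg h0] using this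

lemma phiB_eq {β : ℝ} (hβ : 0 < β) (x : ℝ) : phiB β x = expNegInvGlue (1 - |x| ^ β) := by
  unfold phiB
  split_ifs with h
  · have : |x| ^ β < 1 := Real.rpow_lt_one (abs_nonneg _) h hβ
    simp [expNegInvGlue, not_le.2 this]
  · have : 1 ≤ |x| ^ β := Real.one_le_rpow (not_lt.1 h) hβ.le
    rw [expNegInvGlue.zero_of_nonpos (by linarith)]

def D2 (β c x : ℝ) : ℝ :=
  -c * (expNegInvGlue (1 - |x| ^ β) - β * |x| ^ β * Ed (1 - |x| ^ β))

lemma hasDerivAt_D1 {β : ℝ} (hβ : 2 < β) (c x : ℝ) :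
    HasDerivAt (fun x => -c * x * phiB β x) (D2 β c x) x := by
  have e : (fun x => -c * x * phiB β x) = fun x => -c * x * expNegInvGlue (1 - |x| ^ β) := by
    funext x; rw [phiB_eq (by linarith)]
  rw [e]
  have h1 := (hasDerivAt_abs_rpow x (p := β) (by linarith)).const_sub 1
  have h2 := (hasDerivAt_E (1 - |x| ^ β)).comp x h1
  have h3 := ((hasDerivAt_id x).const_mul (-c)).mul h2
  refine h3.congr_deriv ?_
  have hp : |x| ^ (β - 2) * x ^ 2 = |x| ^ β := by
    rcases eq_or_ne x 0 with rfl | hx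
    · simp [Real.zero_rpow (show β ≠ 0 by linarith)]
    · rw [← sq_abs, ← Real.rpow_natCast |x| 2, ← Real.rpow_add (abs_pos.2 hx)]
      norm_num
  simp only [D2, Function.comp, id]
  linear_combination (c * β * Ed (1 - |x| ^ β)) * hp

lemma continuous_absrpow {β : ℝ} (hβ : 0 < β) : Continuous fun x : ℝ => |x| ^ β :=
  continuous_abs.rpow_const fun _ => Or.inr hβ.le

lemma continuous_D2 {β : ℝ} (hβ : 0 < β) (c : ℝ) : Continuous (D2 β c) := by
  have h := continuous_absrpow hβ
  have h1 : Continuous fun x : ℝ => expNegInvGlue (1 - |x| ^ β) :=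
    continuous_E.comp (continuous_const.sub h)
  have h2 : Continuous fun x : ℝ => Ed (1 - |x| ^ β) :=
    continuous_Ed.comp (continuous_const.sub h)
  unfold D2
  fun_prop

lemma continuous_phiB {β : ℝ} (hβ : 0 < β) : Continuous (phiB β) := by
  have e : phiB β = fun x => expNegInvGlue (1 - |x| ^ β) := funext fun x => phiB_eq hβ x
  rw [e]
  exact continuous_E.comp (continuous_const.sub (continuous_absrpow hβ))

lemma phiB_zero_of {β x : ℝ} (hx : 1 ≤ |x|) : phiB β x = 0 := by
  simp [phiB, not_lt.2 hx]

lemma phiB_pos {β x : ℝ} (hx : |x| < 1) : 0 < phiB β x := by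
  simp [phiB, hx, Real.exp_pos]

lemma D2_zero_of {β c x : ℝ} (hβ : 0 < β) (hx : 1 ≤ |x|) : D2 β c x = 0 := by
  have : 1 ≤ |x| ^ β := Real.one_le_rpow hx hβ.le
  simp [D2, Ed, expNegInvGlue.zero_of_nonpos (show 1 - |x| ^ β ≤ 0 by linarith)]

lemma compact_of {f : ℝ → ℝ} (h : ∀ x, 1 ≤ |x| → f x = 0) : HasCompactSupport f := by
  refine HasCompactSupport.intro (isCompact_Icc (a := (-1:ℝ)) (b := 1)) fun x hx => h x ?_
  by_contra hh
  exact hx (abs_le.1 (not_le.1 hh).le)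

lemma bdd_of {f : ℝ → ℝ} (hf : Continuous f) (h : ∀ x, 1 ≤ |x| → f x = 0) :
    ∃ C, ∀ x, |f x| ≤ C := by
  obtain ⟨C, hC⟩ := hf.bounded_above_of_compact_support (compact_of h)
  exact ⟨C, hC⟩

lemma integ_of {f : ℝ → ℝ} {a b C C' : ℝ} (hf : ContinuousOn f (Ioi 0)) (ha : -1 < a)
    (hb : b < -1) (h0 : ∀ x, 0 < x → x ≤ 1 → |f x| ≤ C * x ^ a)
    (h1 : ∀ x, 1 < x → |f x| ≤ C' * x ^ b) : IntegrableOn f (Ioi 0) := by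
  rw [← Ioc_union_Ioi_eq_Ioi (zero_le_one (α := ℝ))]
  refine IntegrableOn.union ?_ ?_
  · have i : IntegrableOn (fun x : ℝ => C * x ^ a) (Ioc 0 1) := by
      have := (intervalIntegral.intervalIntegrable_rpow' (a := 0) (b := 1) ha)
      rw [intervalIntegrable_iff_integrableOn_Ioc_of_le zero_le_one] at this
      exact this.const_mul C
    refine Integrable.mono' i ((hf.mono Ioc_subset_Ioi_self).aestronglyMeasurable
      measurableSet_Ioc) ?_
    exact ae_restrict_of_forall_mem measurableSet_Ioc fun x hx => h0 x hx.1 hx.2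
  · have i : IntegrableOn (fun x : ℝ => C' * x ^ b) (Ioi 1) :=
      (integrableOn_Ioi_rpow_of_lt hb one_pos).const_mul C'
    refine Integrable.mono' i ((hf.mono (Ioi_subset_Ioi zero_le_one)).aestronglyMeasurable
      measurableSet_Ioi) ?_
    exact ae_restrict_of_forall_mem measurableSet_Ioi fun x hx => h1 x hx

lemma inflection {β c : ℝ} (hβ : 0 < β) (hc : 0 < c) :
    ∃ a > (0 : ℝ), (∀ x, |x| < a → D2 β c x ≤ 0) ∧ (∀ x, a < |x| → 0 ≤ D2 β c x) := by
  obtain ⟨u, hu, hu0⟩ : ∃ u ∈ Icc (0:ℝ) 1, (1 - u) ^ 2 - β * u = 0 := by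
    have := intermediate_value_Icc' (zero_le_one (α := ℝ))
      (f := fun u : ℝ => (1 - u) ^ 2 - β * u) (by fun_prop)
    exact this ⟨by simp [hβ.le], by simp⟩
  have hupos : 0 < u := by
    rcases hu.1.eq_or_lt with h | h
    · rw [← h] at hu0; norm_num at hu0
    · exact h
  have hu1 : u < 1 := by
    rcases hu.2.eq_or_lt with h | h
    · rw [h] at hu0; norm_num at hu0; linarith
    · exact h
  have hpow : (u ^ β⁻¹) ^ β = u := Real.rpow_inv_rpow hu.1 hβ.ne'
  have key : ∀ t : ℝ, t < 1 → expNegInvGlue (1 - t) - β * t * Ed (1 - t)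
      = ((1 - t) ^ 2 - β * t) * Ed (1 - t) := by
    intro t ht
    have : (1 - t) ≠ 0 := by linarith
    simp only [Ed]
    field_simp
  refine ⟨u ^ β⁻¹, Real.rpow_pos_of_pos hupos _, fun x hx => ?_, fun x hx => ?_⟩
  · have ht : |x| ^ β < u := by
      rw [← hpow]; exact Real.rpow_lt_rpow (abs_nonneg _) hx hβ
    have ht0 : 0 ≤ |x| ^ β := by positivity
    rw [D2, key _ (by linarith)]
    have h1 : 0 ≤ (1 - |x| ^ β) ^ 2 - β * |x| ^ β := by nlinarith
    have := mul_nonneg hc.le (mul_nonneg h1 (Ed_nonneg (1 - |x| ^ β)))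
    linarith
  · rcases le_or_gt 1 |x| with h | h
    · rw [D2_zero_of hβ h]
    have ht : u < |x| ^ β := by
      rw [← hpow]; exact Real.rpow_lt_rpow (by positivity) hx hβ
    have ht1 : |x| ^ β < 1 := Real.rpow_lt_one (abs_nonneg _) h hβ
    rw [D2, key _ ht1]
    have h1 : (1 - |x| ^ β) ^ 2 - β * |x| ^ β ≤ 0 := by nlinarith
    have := mul_nonneg hc.le (mul_nonneg (neg_nonneg.2 h1) (Ed_nonneg (1 - |x| ^ β)))
    linarith

theorem kernel_family_satisfies_hypotheses (β α c : ℝ) (hβ : 0 < β)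
    (hα : α < -3) (hαβ : |α + 1| < β)
    (K : ℝ → ℝ) (hc : 0 < c) (hKpdf : IsPDF K)
    (hK' : ∀ x : ℝ, HasDerivAt K (-c * x * phiB β x) x) :
    BellShaped K ∧
    tsupport K = Set.Icc (-1) 1 ∧
    deriv (deriv K) 0 < 0 ∧
    Tendsto (fun x : ℝ => x * K x) atTop (𝓝 0) ∧
    MeasureTheory.Integrable (fun x : ℝ => (deriv K x) ^ 2) ∧
    IntegrableOn
      (fun x : ℝ => x ^ α * ((|deriv (deriv K) 0|⁻¹) ^ 2 * (deriv K x) ^ 2 - x ^ 2))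
      (Set.Ioi 0) ∧
    (∫ x in Set.Ioi (0 : ℝ),
        x ^ α * ((|deriv (deriv K) 0|⁻¹) ^ 2 * (deriv K x) ^ 2 - x ^ 2)) < 0 ∧
    IntegrableOn
      (fun x : ℝ => x ^ α * (1 + |deriv (deriv K) 0|⁻¹ * deriv (deriv K) x))
      (Set.Ioi 0) := by
  have hβ2 : 2 < β := by rw [abs_of_neg (by linarith)] at hαβ; linarith
  have hab : 0 < α + 1 + β := by rw [abs_of_neg (by linarith)] at hαβ; linarith
  have hd1 : deriv K = fun x => -c * x * phiB β x := funext fun x => (hK' x).deriv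
  have hd2 : deriv (deriv K) = D2 β c := by
    rw [hd1]; exact funext fun x => (hasDerivAt_D1 hβ2 c x).deriv
  have hcont : Continuous K := continuous_iff_continuousAt.2 fun x => (hK' x).continuousAt
  have hcphi := continuous_phiB hβ
  have hc1 : Continuous fun x => -c * x * phiB β x := by fun_prop
  have hev : ∀ x, K (-x) = K x := by
    intro x
    have hd : ∀ y, HasDerivAt (fun y => K (-y) - K y) 0 y := by
      intro y
      have h1 := ((hK' (-y)).comp y (hasDerivAt_neg y)).sub (hK' y)
      refine h1.congr_deriv ?_
      have : phiB β (-y) = phiB β y := by simp [phiB]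
      rw [this]; ring
    have := is_const_of_deriv_eq_zero (fun y => (hd y).differentiableAt)
      (fun y => (hd y).deriv) x 0
    simp at this
    linarith
  have habs : ∀ x, K |x| = K x := by
    intro x
    rcases abs_choice x with h | h <;> rw [h]
    exact hev x
  have hanti : StrictAntiOn K (Icc 0 1) := by
    refine strictAntiOn_of_deriv_neg (convex_Icc 0 1) hcont.continuousOn fun x hx => ?_
    rw [interior_Icc] at hx
    rw [hd1]
    have := phiB_pos (β := β) (x := x) (by rw [abs_of_pos hx.1]; exact hx.2)
    have := mul_pos (mul_pos hc hx.1) this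
    simp only
    linarith
  have hconst : ∀ x, 1 ≤ x → K x = K 1 := by
    intro x hx
    refine constant_of_has_deriv_right_zero (a := 1) (b := x) hcont.continuousOn
      (fun y hy => ?_) x ⟨hx, le_rfl⟩
    have := (hK' y).hasDerivWithinAt (s := Ici y)
    rwa [phiB_zero_of (hy.1.trans (le_abs_self y)), mul_zero] at this
  have hK1 : K 1 = 0 := by
    by_contra hne
    have h1 : IntegrableOn (fun _ : ℝ => K 1) (Ioi (1:ℝ)) :=
      (hKpdf.2.1.integrableOn (s := Ioi 1)).congr_fun
        (fun x hx => hconst x (le_of_lt hx)) measurableSet_Ioi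
    rw [integrableOn_const_iff] at h1
    simp [hne] at h1
  have hKz : ∀ x, 1 ≤ |x| → K x = 0 := fun x hx => by rw [← habs, hconst _ hx, hK1]
  have hKpos : ∀ x, |x| < 1 → 0 < K x := by
    intro x hx
    rw [← habs, ← hK1]
    exact hanti ⟨abs_nonneg _, hx.le⟩ (by simp) hx
  have hE1 : 0 < expNegInvGlue 1 := expNegInvGlue.pos_of_pos one_pos
  have hD0 : D2 β c 0 = -c * expNegInvGlue 1 := by
    simp [D2, Real.zero_rpow hβ.ne']
  have hDabs : |D2 β c 0| = c * expNegInvGlue 1 := by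
    rw [hD0, abs_of_neg (by nlinarith [mul_pos hc hE1])]; ring
  obtain ⟨M, hM0, hM⟩ := E_lip
  set e := expNegInvGlue 1 with he
  have hpow : ContinuousOn (fun x : ℝ => x ^ α) (Ioi 0) :=
    continuousOn_id.rpow_const fun x hx => Or.inl (ne_of_gt hx)
  -- first integrand
  have hcD2 := continuous_D2 hβ c
  have f1c : ContinuousOn (fun x : ℝ => x ^ α * ((|D2 β c 0|⁻¹) ^ 2 *
      (-c * x * phiB β x) ^ 2 - x ^ 2)) (Ioi 0) :=
    hpow.mul (Continuous.continuousOn (by fun_prop))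
  have f1eq : ∀ x : ℝ, 0 < x → x ^ α * ((|D2 β c 0|⁻¹) ^ 2 * (-c * x * phiB β x) ^ 2 - x ^ 2)
      = -(x ^ (α + 2) * (1 - (phiB β x / e) ^ 2)) := by
    intro x hx
    rw [Real.rpow_add hx, hDabs, Real.rpow_two]
    field_simp
    ring
  have hr : ∀ x, 0 ≤ phiB β x / e ∧ phiB β x / e ≤ 1 := by
    intro x
    rw [phiB_eq hβ]
    refine ⟨div_nonneg (expNegInvGlue.nonneg _) hE1.le, (div_le_one hE1).2 ?_⟩
    exact expNegInvGlue.monotone (by have : 0 ≤ |x| ^ β := by positivity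
                                     linarith)
  have hp1 : ∀ x : ℝ, 1 < x → phiB β x = 0 := fun x hx =>
    phiB_zero_of (hx.le.trans (le_abs_self x))
  have hlip : ∀ x : ℝ, 0 < x → x ≤ 1 → 1 - phiB β x / e ≤ M / e * x ^ β := by
    intro x h0 h1
    have := (abs_le.1 (hM (x ^ β) (by positivity) (Real.rpow_le_one h0.le h1 hβ.le)).2).2
    rw [phiB_eq hβ, abs_of_pos h0, one_sub_div hE1.ne', div_mul_eq_mul_div]
    gcongr
  have f1int : IntegrableOn (fun x : ℝ => x ^ α * ((|D2 β c 0|⁻¹) ^ 2 *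
      (-c * x * phiB β x) ^ 2 - x ^ 2)) (Ioi 0) := by
    refine integ_of (a := α + 2 + β) (b := α + 2) (C := 2 * (M / e)) (C' := 1) f1c
      (by linarith) (by linarith) (fun x h0 h1 => ?_) (fun x h1 => ?_)
    · rw [f1eq x h0, abs_neg, abs_mul, abs_of_pos (Real.rpow_pos_of_pos h0 _),
        Real.rpow_add h0 (α + 2) β]
      have ⟨r0, r1⟩ := hr x
      have hl := hlip x h0 h1
      have : |1 - (phiB β x / e) ^ 2| ≤ 2 * (M / e * x ^ β) := by
        rw [abs_of_nonneg (by nlinarith)]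
        nlinarith
      calc _ ≤ x ^ (α + 2) * (2 * (M / e * x ^ β)) :=
            mul_le_mul_of_nonneg_left this (Real.rpow_pos_of_pos h0 _).le
        _ = _ := by ring
    · have h0 : 0 < x := by linarith
      rw [f1eq x h0, hp1 x h1, abs_neg]
      simp [abs_of_pos (Real.rpow_pos_of_pos h0 (α + 2))]
  have f1neg : (∫ x in Ioi (0:ℝ), x ^ α * ((|D2 β c 0|⁻¹) ^ 2 *
      (-c * x * phiB β x) ^ 2 - x ^ 2)) < 0 := by
    have h := setIntegral_mono_set (s := Ioi (1:ℝ)) (t := Ioi (0:ℝ)) f1int.neg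
      (ae_restrict_of_forall_mem measurableSet_Ioi fun x hx => by
        have ⟨r0, r1⟩ := hr x
        simp only [Pi.zero_apply, Pi.neg_apply]
        rw [f1eq x hx, neg_neg]
        exact mul_nonneg (Real.rpow_pos_of_pos hx _).le (by nlinarith))
      (HasSubset.Subset.eventuallyLE (Ioi_subset_Ioi zero_le_one))
    have h2 : (∫ x in Ioi (1:ℝ), (-fun x : ℝ => x ^ α * ((|D2 β c 0|⁻¹) ^ 2 *
      (-c * x * phiB β x) ^ 2 - x ^ 2)) x) = ∫ x in Ioi (1:ℝ), x ^ (α + 2) := by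
      refine setIntegral_congr_fun measurableSet_Ioi fun x hx => ?_
      have hx' : (1:ℝ) < x := hx
      simp only [Pi.neg_apply]
      rw [f1eq x (by linarith), hp1 x hx]
      simp
    rw [h2, integral_Ioi_rpow_of_lt (by linarith) one_pos, Real.one_rpow] at h
    have h3 : 0 < (-1 : ℝ) / (α + 2 + 1) := div_pos_of_neg_of_neg (by norm_num) (by linarith)
    simp only [Pi.neg_apply] at h
    rw [integral_neg] at h
    linarith
  have f2int : IntegrableOn (fun x : ℝ => x ^ α * (1 + |D2 β c 0|⁻¹ * D2 β c x)) (Ioi 0) := by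
    refine integ_of (a := α + β) (b := α) (C := (1 + β) * (M / e)) (C' := 1)
      (hpow.mul (Continuous.continuousOn (by fun_prop)))
      (by linarith) (by linarith) (fun x h0 h1 => ?_) (fun x h1 => ?_)
    · rw [abs_mul, abs_of_pos (Real.rpow_pos_of_pos h0 _), Real.rpow_add h0]
      have ht0 : 0 ≤ x ^ β := by positivity
      obtain ⟨m1, m2⟩ := hM (x ^ β) ht0 (Real.rpow_le_one h0.le h1 hβ.le)
      have e1 : 1 + |D2 β c 0|⁻¹ * D2 β c x
          = ((e - expNegInvGlue (1 - x ^ β)) + β * x ^ β * Ed (1 - x ^ β)) / e := by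
        rw [hDabs, D2, abs_of_pos h0]
        field_simp
        ring
      have : |1 + |D2 β c 0|⁻¹ * D2 β c x| ≤ (1 + β) * (M / e) * x ^ β := by
        rw [e1, abs_div, abs_of_pos hE1, div_le_iff₀ hE1]
        refine (abs_add_le _ _).trans ?_
        rw [abs_of_nonneg (mul_nonneg (by positivity) (Ed_nonneg (1 - x ^ β)))]
        have : β * x ^ β * Ed (1 - x ^ β) ≤ β * x ^ β * M :=
          mul_le_mul_of_nonneg_left m1 (by positivity)
        calc _ ≤ M * x ^ β + β * x ^ β * M := add_le_add m2 this
          _ = _ := by field_simp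
      calc _ ≤ x ^ α * ((1 + β) * (M / e) * x ^ β) :=
            mul_le_mul_of_nonneg_left this (Real.rpow_pos_of_pos h0 _).le
        _ = _ := by ring
    · have h0 : 0 < x := by linarith
      rw [D2_zero_of hβ (h1.le.trans (le_abs_self x))]
      simp [abs_of_pos (Real.rpow_pos_of_pos h0 α)]
  have hsupp : Function.support K = Ioo (-1) 1 := by
    ext x
    rw [Function.mem_support, mem_Ioo, ← abs_lt]
    refine ⟨fun h => ?_, fun h => (hKpos x h).ne'⟩
    by_contra hh
    exact h (hKz x (not_lt.1 hh))
  have hz1 : ∀ x, 1 ≤ |x| → -c * x * phiB β x = 0 := fun x hx => by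
    rw [phiB_zero_of hx, mul_zero]
  rw [hd2, hd1]
  refine ⟨⟨hKpdf, ?_, ?_, ?_, ?_, ?_, ?_⟩, ?_, ?_, ?_, ?_, f1int, f1neg, f2int⟩
  · have h2 : ContDiff ℝ 1 (deriv K) := by
      rw [contDiff_one_iff_deriv, hd2]
      refine ⟨?_, hcD2⟩
      rw [hd1]
      exact fun x => (hasDerivAt_D1 hβ2 c x).differentiableAt
    have : ContDiff ℝ (1 + 1) K := by
      rw [contDiff_succ_iff_deriv]
      exact ⟨fun x => (hK' x).differentiableAt, by simp, h2⟩
    simpa [one_add_one_eq_two] using this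
  · intro x
    simp [hev]
  · intro x y hxy hy
    rw [zero_add] at hy
    rw [zero_add, zero_add, ← habs x, ← habs y]
    have hy1 : |y| < 1 := by
      by_contra hh
      exact hy (hKz y (not_lt.1 hh))
    exact hanti ⟨abs_nonneg _, (hxy.trans hy1).le⟩ ⟨abs_nonneg _, hy1.le⟩ hxy
  · rw [hd1]
    exact bdd_of hc1 hz1
  · rw [hd2]
    exact bdd_of hcD2 fun x hx => D2_zero_of hβ hx
  · rw [hd2]
    exact inflection hβ hc
  · rw [tsupport, hsupp, closure_Ioo (by norm_num)]
  · rw [hD0]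
    nlinarith [mul_pos hc hE1]
  · refine tendsto_const_nhds.congr' ?_
    filter_upwards [eventually_ge_atTop (1:ℝ)] with x hx
    rw [hKz x (hx.trans (le_abs_self x)), mul_zero]
  · refine Continuous.integrable_of_hasCompactSupport (by fun_prop) (compact_of fun x hx => ?_)
    simp [phiB_zero_of hx]
end
end
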